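/- arXiv:2009.08125 — 2 statements merged into one kernel-verified Lean document; each statement's English description precedes it below -/
import Mathlib

section
/- Let n ≥ 2, m ≥ 1 and let J_{n,m} = ⟨ y_i^m (1 ≤ i ≤ n), y_1^{m−k} y_j^{k} (2 ≤ j ≤ n, 1 ≤ k ≤ m−1) ⟩ ⊆ k[y_1,…,y_n]. Then for every 1 ≤ i ≤ n−1, β_i(J_{n,m}) = C(n−1, i) + Σ_{j=2}^{n} (m−1)·C(1+n−j, i) + C(n−1, i+1), and β_i(J_{n,m}) = 0 for all i ≥ n. In particular projdim(J_{n,m}) = n−1. -/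
open MvPolynomial CategoryTheory

/-- The `i`-th total Betti number of `I ⊆ R = 𝕜[x_j : j ∈ σ]`:
`β_i(I) = dim_𝕜 Tor_i^R(I, 𝕜)`, where `𝕜` carries the `R`-module structure of the
residue field `R ⧸ (x_j : j ∈ σ)`. -/
noncomputable def betti (𝕜 : Type) [Field 𝕜] {σ : Type} (I : Ideal (MvPolynomial σ 𝕜)) (i : ℕ) :
    Cardinal :=
  Module.rank 𝕜 (RestrictScalars 𝕜 (MvPolynomial σ 𝕜)
    (((Tor (ModuleCat (MvPolynomial σ 𝕜)) i).obj (ModuleCat.of _ I)).obj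
      (ModuleCat.of _ (MvPolynomial σ 𝕜 ⧸ Ideal.span (Set.range (X : σ → MvPolynomial σ 𝕜))))))

namespace BettiAux
open MonoidalCategory

section Package
variable {R : Type} [CommRing R]

/-- tensoring a fixed complex with a module, functorially in the module -/
noncomputable def KF (P : ChainComplex (ModuleCat.{0} R) ℕ) :
    ModuleCat.{0} R ⥤ ChainComplex (ModuleCat.{0} R) ℕ where
  obj M := (((tensoringLeft (ModuleCat.{0} R)).obj M).mapHomologicalComplex _).obj P
  map f := (NatTrans.mapHomologicalComplex ((tensoringLeft (ModuleCat.{0} R)).map f) _).app P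
  map_id M := by ext i : 1; simp
  map_comp f g := by ext i : 1; simp

instance (P : ChainComplex (ModuleCat.{0} R) ℕ) : (KF P).Additive where
  map_add {M N f g} := by
    ext i : 1
    exact MonoidalPreadditive.add_whiskerRight f g

lemma KF_shortExact (P : ChainComplex (ModuleCat.{0} R) ℕ) (hP : ∀ i, Projective (P.X i))
    (S : ShortComplex (ModuleCat.{0} R)) (hS : S.ShortExact) : (S.map (KF P)).ShortExact := by
  apply HomologicalComplex.shortExact_of_degreewise_shortExact
  intro i
  have : Module.Flat R (P.X i) := by
    have h1 : Module.Projective R (P.X i) := (IsProjective.iff_projective (R := R) (P.X i)).2 (hP i)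
    infer_instance
  exact hS.map_of_exact (tensorRight (P.X i))

variable {k : ModuleCat.{0} R} (P : ProjectiveResolution k)
variable {A B C A' B' C' : Type} [AddCommGroup A] [Module R A] [AddCommGroup B] [Module R B]
  [AddCommGroup C] [Module R C] [AddCommGroup A'] [Module R A'] [AddCommGroup B'] [Module R B']
  [AddCommGroup C'] [Module R C']

/-- `Tor_i(A, k)` computed with the resolution `P` of `k`. -/
noncomputable def T (i : ℕ) (A : Type) [AddCommGroup A] [Module R A] : ModuleCat.{0} R :=
  ((KF P.complex).obj (ModuleCat.of R A)).homology i

/-- functoriality of `T` -/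
noncomputable def Tm (i : ℕ) (f : A →ₗ[R] B) : T P i A →ₗ[R] T P i B :=
  (HomologicalComplex.homologyMap ((KF P.complex).map (ModuleCat.ofHom f)) i).hom

lemma Tm_comp (i : ℕ) (f : A →ₗ[R] B) (g : B →ₗ[R] C) (x : T P i A) :
    Tm P i (g ∘ₗ f) x = Tm P i g (Tm P i f x) := by
  simp only [Tm, ModuleCat.ofHom_comp, Functor.map_comp, HomologicalComplex.homologyMap_comp,
    ModuleCat.hom_comp]
  rfl

lemma Tm_id (i : ℕ) (x : T P i A) :
    Tm P i (LinearMap.id : A →ₗ[R] A) x = x := by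
  simp only [Tm, ModuleCat.ofHom_id, CategoryTheory.Functor.map_id, HomologicalComplex.homologyMap_id,
    ModuleCat.hom_id]
  rfl

lemma Tm_zero (i : ℕ) : Tm P i (0 : A →ₗ[R] B) = 0 := by
  simp only [Tm, ModuleCat.ofHom_zero, Functor.map_zero, HomologicalComplex.homologyMap_zero,
    ModuleCat.hom_zero]
  rfl

/-- an isomorphism between `Tor` and `T` -/
noncomputable def torIso (i : ℕ) (A : Type) [AddCommGroup A] [Module R A] :
    ((Tor (ModuleCat R) i).obj (ModuleCat.of R A)).obj k ≅ T P i A :=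
  P.isoLeftDerivedObj ((tensoringLeft (ModuleCat R)).obj (ModuleCat.of R A)) i

/-- the short complex of an exact pair -/
noncomputable abbrev SC (f : A →ₗ[R] B) (g : B →ₗ[R] C) (h : Function.Exact f g) :
    ShortComplex (ModuleCat.{0} R) :=
  ShortComplex.mk (ModuleCat.ofHom f) (ModuleCat.ofHom g)
    (ModuleCat.hom_ext (DFunLike.ext _ _ h.apply_apply_eq_zero))

lemma SC_shortExact {f : A →ₗ[R] B} {g : B →ₗ[R] C} (hf : Function.Injective f)
    (h : Function.Exact f g) (hg : Function.Surjective g) :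
    ((SC f g h).map (KF P.complex)).ShortExact := by
  apply KF_shortExact _ P.projective
  have := (ModuleCat.mono_iff_injective (SC f g h).f).2 hf
  have := (ModuleCat.epi_iff_surjective (SC f g h).g).2 hg
  constructor
  rw [ShortComplex.ShortExact.moduleCat_exact_iff_function_exact]
  exact h

/-- connecting map -/
noncomputable def del {f : A →ₗ[R] B} {g : B →ₗ[R] C} (hf : Function.Injective f)
    (h : Function.Exact f g) (hg : Function.Surjective g) (i : ℕ) :
    T P (i + 1) C →ₗ[R] T P i A :=
  ((SC_shortExact P hf h hg).δ (i + 1) i (by simp)).hom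

variable {f : A →ₗ[R] B} {g : B →ₗ[R] C} (hf : Function.Injective f)
    (h : Function.Exact f g) (hg : Function.Surjective g)
    {f' : A' →ₗ[R] B'} {g' : B' →ₗ[R] C'} (hf' : Function.Injective f')
    (h' : Function.Exact f' g') (hg' : Function.Surjective g')

lemma exact_mid (hf : Function.Injective f)
    (h : Function.Exact f g) (hg : Function.Surjective g) (i : ℕ) : Function.Exact (Tm P i f) (Tm P i g) := by
  have := (SC_shortExact P hf h hg).homology_exact₂ i
  rw [ShortComplex.ShortExact.moduleCat_exact_iff_function_exact] at this
  exact this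

lemma exact_right (i : ℕ) : Function.Exact (Tm P (i + 1) g) (del P hf h hg i) := by
  have := (SC_shortExact P hf h hg).homology_exact₃ (i + 1) i (by simp)
  rw [ShortComplex.ShortExact.moduleCat_exact_iff_function_exact] at this
  exact this

lemma exact_left (i : ℕ) : Function.Exact (del P hf h hg i) (Tm P i f) := by
  have := (SC_shortExact P hf h hg).homology_exact₁ (i + 1) i (by simp)
  rw [ShortComplex.ShortExact.moduleCat_exact_iff_function_exact] at this
  exact this

lemma surj_zero (hf : Function.Injective f)
    (h : Function.Exact f g) (hg : Function.Surjective g) : Function.Surjective (Tm P 0 g) := by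
  have hE := SC_shortExact P hf h hg
  have := hE.epi_g
  have : Epi (HomologicalComplex.homologyMap ((SC f g h).map (KF P.complex)).g 0) := by
    apply HomologicalComplex.epi_homologyMap_of_epi_of_not_rel
    simp
  exact (ModuleCat.epi_iff_surjective _).1 this

lemma del_nat (a : A →ₗ[R] A') (b : B →ₗ[R] B') (c : C →ₗ[R] C')
    (h1 : f' ∘ₗ a = b ∘ₗ f) (h2 : g' ∘ₗ b = c ∘ₗ g) (i : ℕ) (x : T P (i + 1) C) :
    Tm P i a (del P hf h hg i x) = del P hf' h' hg' i (Tm P (i + 1) c x) := by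
  let φ : SC f g h ⟶ SC f' g' h' :=
    { τ₁ := ModuleCat.ofHom a
      τ₂ := ModuleCat.ofHom b
      τ₃ := ModuleCat.ofHom c
      comm₁₂ := ModuleCat.hom_ext h1
      comm₂₃ := ModuleCat.hom_ext h2 }
  have := HomologicalComplex.HomologySequence.δ_naturality
    ((KF P.complex).mapShortComplex.map φ) (SC_shortExact P hf h hg)
    (SC_shortExact P hf' h' hg') (i + 1) i (by simp)
  exact congrArg (fun u => u.hom x) this

lemma Tm_smul (r : R) (hr : ∀ x : k, r • x = 0) (i : ℕ) :
    Tm P i (r • (LinearMap.id : A →ₗ[R] A)) = 0 := by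
  have hom : Homotopy (r • 𝟙 P.complex) 0 := by
    apply ProjectiveResolution.liftHomotopyZero
    ext : 1
    apply ModuleCat.hom_ext
    ext x
    have h5 : (P.π.f 0).hom (r • x) = 0 := by
      rw [map_smul]; exact hr _
    exact h5
  have h2 := (((tensoringLeft (ModuleCat R)).obj (ModuleCat.of R A)).mapHomotopy hom).homologyMap_eq i
  have h3 : (KF P.complex).map (ModuleCat.ofHom (r • (LinearMap.id : A →ₗ[R] A))) =
      (((tensoringLeft (ModuleCat R)).obj (ModuleCat.of R A)).mapHomologicalComplex _).map
        (r • 𝟙 P.complex) := by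
    ext j : 1
    apply ModuleCat.hom_ext
    apply TensorProduct.ext'
    intro x y
    exact TensorProduct.smul_tmul _ _ _
  rw [Functor.map_zero, HomologicalComplex.homologyMap_zero] at h2
  have h4 : HomologicalComplex.homologyMap ((KF P.complex).map
      (ModuleCat.ofHom (r • (LinearMap.id : A →ₗ[R] A)))) i = 0 :=
    (congrArg (fun u => HomologicalComplex.homologyMap u i) h3).trans h2
  rw [Tm, h4]
  rfl

lemma T_ring_succ (i : ℕ) : Limits.IsZero (T P (i + 1) R) := by
  have e : (KF P.complex).obj (ModuleCat.of R R) ≅ P.complex :=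
    HomologicalComplex.Hom.isoOfComponents (fun i => λ_ (P.complex.X i)) (by
      intro i j _
      exact (leftUnitor_naturality _).symm)
  have := (HomologicalComplex.exactAt_iff_isZero_homology _ _).1 (P.complex_exactAt_succ i)
  exact this.of_iso ((HomologicalComplex.homologyFunctor _ _ _).mapIso e)

lemma T_ring_zero : Nonempty (T P 0 R ≅ k) := by
  have e : (KF P.complex).obj (ModuleCat.of R R) ≅ P.complex :=
    HomologicalComplex.Hom.isoOfComponents (fun i => λ_ (P.complex.X i)) (by
      intro i j _
      exact (leftUnitor_naturality _).symm)
  have h1 : QuasiIsoAt P.π 0 := inferInstance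
  have h2 := (quasiIsoAt_iff_isIso_homologyMap P.π 0).1 h1
  exact ⟨(HomologicalComplex.homologyFunctor _ _ _).mapIso e ≪≫
    @asIso _ _ _ _ (HomologicalComplex.homologyMap P.π 0) h2 ≪≫
    HomologicalComplex.singleObjHomologySelfIso _ _ _⟩

end Package

section Ideals
variable {R : Type} [CommRing R]

/-- multiplication by `x` as a map `R/I → R/I'` -/
def mm (I I' : Ideal R) (x : R) (h : ∀ a ∈ I, x * a ∈ I') : (R ⧸ I) →ₗ[R] (R ⧸ I') :=
  Submodule.mapQ I I' (x • LinearMap.id) (fun a ha => by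
    rw [Submodule.mem_comap]; exact h a ha)

lemma mm_mk (I I' : Ideal R) (x : R) (h : ∀ a ∈ I, x * a ∈ I') (a : R) :
    mm I I' x h (Submodule.Quotient.mk a) = Submodule.Quotient.mk (x * a) := rfl

lemma mm_comp (I I' I'' : Ideal R) (x y : R) (h : ∀ a ∈ I, x * a ∈ I')
    (h' : ∀ a ∈ I', y * a ∈ I'') (h'' : ∀ a ∈ I, (y * x) * a ∈ I'') :
    mm I' I'' y h' ∘ₗ mm I I' x h = mm I I'' (y * x) h'' := by
  refine LinearMap.ext fun b => ?_
  obtain ⟨a, rfl⟩ := Submodule.Quotient.mk_surjective _ b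
  rw [LinearMap.comp_apply, mm_mk, mm_mk, mm_mk, mul_assoc]

lemma mm_self (I : Ideal R) (x : R) (h : ∀ a ∈ I, x * a ∈ I) :
    mm I I x h = x • LinearMap.id := by
  ext a
  rfl

lemma mm_congr (I I' : Ideal R) (x y : R) (e : x = y) (h : ∀ a ∈ I, x * a ∈ I') :
    mm I I' x h = mm I I' y (e ▸ h) := by subst e; rfl

lemma one_aux {I I' : Ideal R} (h : I ≤ I') : ∀ a ∈ I, 1 * a ∈ I' := by
  intro a ha; rw [one_mul]; exact h ha

lemma mul_aux {I I' : Ideal R} (h : I ≤ I') : ∀ a ∈ I, (1 * 1) * a ∈ I' := by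
  intro a ha; rw [one_mul, one_mul]; exact h ha

/-- projection -/
abbrev pr (I I' : Ideal R) (h : I ≤ I') : (R ⧸ I) →ₗ[R] (R ⧸ I') := mm I I' 1 (one_aux h)

lemma pr_surj (I I' : Ideal R) (h : I ≤ I') : Function.Surjective (pr I I' h) := by
  intro y
  obtain ⟨a, rfl⟩ := Submodule.Quotient.mk_surjective _ y
  exact ⟨Submodule.Quotient.mk a, by rw [mm_mk, one_mul]⟩

lemma mm_inj (I I' : Ideal R) (x : R) (h : ∀ a, x * a ∈ I' ↔ a ∈ I) :
    Function.Injective (mm I I' x (fun a => (h a).2)) := by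
  rw [injective_iff_map_eq_zero]
  intro y hy
  obtain ⟨a, rfl⟩ := Submodule.Quotient.mk_surjective _ y
  rw [mm_mk, Submodule.Quotient.mk_eq_zero, h] at hy
  rwa [Submodule.Quotient.mk_eq_zero]

lemma mm_exact (I I' : Ideal R) (x : R) (h : ∀ a ∈ I, x * a ∈ I') (I'' : Ideal R)
    (hs : I'' = I' ⊔ Ideal.span {x}) :
    Function.Exact (mm I I' x h) (pr I' I'' (hs ▸ le_sup_left)) := by
  intro y
  obtain ⟨a, rfl⟩ := Submodule.Quotient.mk_surjective _ y
  rw [mm_mk, one_mul, Submodule.Quotient.mk_eq_zero]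
  constructor
  · intro ha
    rw [hs, Submodule.mem_sup] at ha
    obtain ⟨u, hu, v, hv, rfl⟩ := ha
    obtain ⟨c, rfl⟩ := Ideal.mem_span_singleton'.1 hv
    refine ⟨Submodule.Quotient.mk c, ?_⟩
    rw [mm_mk, Submodule.Quotient.eq]
    have : x * c - (u + c * x) = -u := by ring
    rw [this]
    exact neg_mem hu
  · rintro ⟨z, hz⟩
    obtain ⟨c, rfl⟩ := Submodule.Quotient.mk_surjective _ z
    rw [mm_mk, Submodule.Quotient.eq] at hz
    have : a = x * c - (x * c - a) := by ring
    rw [this, hs]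
    refine sub_mem ?_ (Ideal.mem_sup_left hz)
    exact Ideal.mem_sup_right (Ideal.mul_mem_right _ _ (Ideal.mem_span_singleton_self x))

variable {k : ModuleCat.{0} R} (P : ProjectiveResolution k)

/-- vanishing step -/
lemma vanish_step (I I' : Ideal R) (hI : I ≤ I') (x y : R) (hy : ∀ u : k, y • u = 0)
    (hx1 : ∀ a, x * a ∈ I ↔ a ∈ I) (hyx : ∀ a, (y * x) * a ∈ I ↔ a ∈ I)
    (K K' : Ideal R) (hK : K = I ⊔ Ideal.span {y * x}) (hK' : K' = I' ⊔ Ideal.span {x})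
    (hKK : K ≤ K') (i : ℕ) (hv : Tm P (i + 1) (pr I I' hI) = 0) :
    Tm P (i + 1) (pr K K' hKK) = 0 := by
  set L : Ideal R := I ⊔ Ideal.span {x} with hL
  have hKL : K ≤ L := by
    rw [hK, hL]
    refine sup_le_sup_left ?_ _
    rw [Ideal.span_singleton_le_span_singleton]
    exact Dvd.intro_left _ rfl
  have hLK' : L ≤ K' := by rw [hL, hK']; exact sup_le_sup_right hI _
  have hIL : I ≤ L := le_sup_left
  have hIK' : I' ≤ K' := hK' ▸ le_sup_left
  have hIK : I ≤ K := hK ▸ le_sup_left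
  ext z
  have e1 : pr K K' hKK = pr L K' hLK' ∘ₗ pr K L hKL := by
    rw [mm_comp _ _ _ _ _ _ _ (mul_aux (hKK))]
    exact mm_congr _ _ _ _ (by ring) _
  have e2 : pr L K' hLK' ∘ₗ pr I L hIL = pr I' K' hIK' ∘ₗ pr I I' hI := by
    rw [mm_comp _ _ _ _ _ _ _ (mul_aux (hIL.trans hLK')),
      mm_comp _ _ _ _ _ _ _ (mul_aux (hIL.trans hLK'))]
  have hd : del P (mm_inj I I x hx1) (mm_exact I I x _ L hL) (pr_surj _ _ _) i
      (Tm P (i + 1) (pr K L hKL) z) = 0 := by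
    rw [← del_nat P (mm_inj I I (y * x) hyx) (mm_exact I I (y * x) _ K hK) (pr_surj _ _ _)
      (mm_inj I I x hx1) (mm_exact I I x _ L hL) (pr_surj _ _ _)
      (mm I I y (fun a ha => Ideal.mul_mem_left _ _ ha)) LinearMap.id (pr K L hKL), mm_self,
      Tm_smul P y hy]
    · rfl
    · rw [mm_comp _ _ _ _ _ _ _ (fun a ha => Ideal.mul_mem_left _ _ ha), LinearMap.id_comp]
      exact mm_congr _ _ _ _ (by ring) _
    · rw [mm_comp _ _ _ _ _ _ _ (mul_aux (hIL)), LinearMap.comp_id]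
      exact mm_congr _ _ _ _ (by ring) _
  rw [exact_right P (mm_inj I I x hx1) (mm_exact I I x _ L hL) (pr_surj _ _ _) i] at hd
  obtain ⟨a, ha⟩ := hd
  rw [e1, Tm_comp, ← ha, ← Tm_comp, e2, Tm_comp, hv]
  simp

end Ideals

section Rank
variable {R : Type} [CommRing R] (𝕜 : Type) [Field 𝕜] [Algebra 𝕜 R]

/-- rank over the ground field -/
noncomputable def rk (M : Type) [AddCommGroup M] [Module R M] : Cardinal.{0} :=
  Module.rank 𝕜 (RestrictScalars 𝕜 R M)

variable {A B C : Type} [AddCommGroup A] [Module R A] [AddCommGroup B] [Module R B]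
  [AddCommGroup C] [Module R C]

/-- restriction of scalars of a map -/
def rs (f : A →ₗ[R] B) : RestrictScalars 𝕜 R A →ₗ[𝕜] RestrictScalars 𝕜 R B where
  toFun := f
  map_add' := f.map_add
  map_smul' c x := f.map_smul (algebraMap 𝕜 R c) x

lemma rk_exact (f : A →ₗ[R] B) (g : B →ₗ[R] C) (hf : Function.Injective f)
    (h : Function.Exact f g) (hg : Function.Surjective g) :
    rk (R := R) 𝕜 B = rk (R := R) 𝕜 A + rk (R := R) 𝕜 C := by
  let iA : Module 𝕜 A := Module.compHom A (algebraMap 𝕜 R)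
  let iB : Module 𝕜 B := Module.compHom B (algebraMap 𝕜 R)
  let iC : Module 𝕜 C := Module.compHom C (algebraMap 𝕜 R)
  let f' : A →ₗ[𝕜] B := rs 𝕜 f
  let g' : B →ₗ[𝕜] C := rs 𝕜 g
  have h1 := LinearMap.rank_range_add_rank_ker g'
  rw [LinearMap.range_eq_top.2 (show Function.Surjective g' from hg), rank_top,
    show LinearMap.ker g' = LinearMap.range f' from
      LinearMap.exact_iff.1 (show Function.Exact f' g' from h),
    rank_range_of_injective _ (show Function.Injective f' from hf), add_comm] at h1
  exact h1.symm

lemma rk_bij (f : A →ₗ[R] B) (hf : Function.Bijective f) :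
    rk (R := R) 𝕜 A = rk (R := R) 𝕜 B :=
  (LinearEquiv.ofBijective (rs 𝕜 f) hf).rank_eq

lemma rk_one (v : A) (hv : v ≠ 0) (h : ∀ w : A, ∃ c : 𝕜, (algebraMap 𝕜 R c) • v = w) :
    rk (R := R) 𝕜 A = 1 := by
  let iA : Module 𝕜 A := Module.compHom A (algebraMap 𝕜 R)
  have h1 : Module.rank 𝕜 A = 1 := rank_eq_one v hv h
  exact h1

lemma rk_subsingleton [Subsingleton A] : rk (R := R) 𝕜 A = 0 := by
  have : Subsingleton (RestrictScalars 𝕜 R A) := ‹Subsingleton A›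
  exact rank_subsingleton' _ _

variable {k : ModuleCat.{0} R} (P : ProjectiveResolution k)

/-- Betti number of `A` -/
noncomputable abbrev bt (i : ℕ) (A : Type) [AddCommGroup A] [Module R A] : Cardinal.{0} :=
  rk (R := R) 𝕜 (T P i A)

lemma bt_reg_zero (I : Ideal R) (x : R) (hx : ∀ u : k, x • u = 0)
    (hx1 : ∀ a, x * a ∈ I ↔ a ∈ I) (L : Ideal R) (hL : L = I ⊔ Ideal.span {x}) :
    bt 𝕜 P 0 (R ⧸ L) = bt 𝕜 P 0 (R ⧸ I) := by
  refine (rk_bij 𝕜 (Tm P 0 (pr I L (hL ▸ le_sup_left))) ⟨?_, ?_⟩).symm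
  · rw [injective_iff_map_eq_zero]
    intro z hz
    rw [exact_mid P (mm_inj I I x hx1) (mm_exact I I x _ L hL) (pr_surj _ _ _) 0] at hz
    obtain ⟨w, rfl⟩ := hz
    rw [mm_self, Tm_smul P x hx]
    rfl
  · exact surj_zero P (mm_inj I I x hx1) (mm_exact I I x _ L hL) (pr_surj _ _ _)

lemma bt_reg_succ (I : Ideal R) (x : R) (hx : ∀ u : k, x • u = 0)
    (hx1 : ∀ a, x * a ∈ I ↔ a ∈ I) (L : Ideal R) (hL : L = I ⊔ Ideal.span {x}) (i : ℕ) :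
    bt 𝕜 P (i + 1) (R ⧸ L) = bt 𝕜 P (i + 1) (R ⧸ I) + bt 𝕜 P i (R ⧸ I) := by
  refine rk_exact 𝕜 (Tm P (i + 1) (pr I L (hL ▸ le_sup_left)))
    (del P (mm_inj I I x hx1) (mm_exact I I x _ L hL) (pr_surj _ _ _) i) ?_ ?_ ?_
  · rw [injective_iff_map_eq_zero]
    intro z hz
    rw [exact_mid P (mm_inj I I x hx1) (mm_exact I I x _ L hL) (pr_surj _ _ _) (i + 1)] at hz
    obtain ⟨w, rfl⟩ := hz
    rw [mm_self, Tm_smul P x hx]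
    rfl
  · exact exact_right P (mm_inj I I x hx1) (mm_exact I I x _ L hL) (pr_surj _ _ _) i
  · intro z
    rw [← Set.mem_range,
      ← exact_left P (mm_inj I I x hx1) (mm_exact I I x _ L hL) (pr_surj _ _ _) i,
      mm_self, Tm_smul P x hx]
    rfl

lemma bt_step (Q J1 J2 K : Ideal R) (x : R) (hQ : ∀ a, x * a ∈ Q ↔ a ∈ Q)
    (hJ : ∀ a, x * a ∈ J2 ↔ a ∈ J1) (hKQ : K = Q ⊔ Ideal.span {x})
    (hKJ : K = J2 ⊔ Ideal.span {x}) (h1 : Q ≤ J1) (h2 : Q ≤ J2)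
    (hv : ∀ i, Tm P (i + 1) (pr Q J1 h1) = 0) (i : ℕ) :
    bt 𝕜 P (i + 2) (R ⧸ J2) = bt 𝕜 P (i + 2) (R ⧸ J1) + bt 𝕜 P (i + 2) (R ⧸ K) := by
  have hd : ∀ (i : ℕ) z, del P (mm_inj J1 J2 x hJ) (mm_exact J1 J2 x _ K hKJ)
      (pr_surj _ _ _) (i + 1) z = 0 := by
    intro i z
    have := del_nat P (mm_inj Q Q x hQ) (mm_exact Q Q x _ K hKQ) (pr_surj _ _ _)
      (mm_inj J1 J2 x hJ) (mm_exact J1 J2 x _ K hKJ) (pr_surj _ _ _)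
      (pr Q J1 h1) (pr Q J2 h2) LinearMap.id (by
        rw [mm_comp _ _ _ _ _ _ _ (fun a ha => h2 (Ideal.mul_mem_left _ _ ha)),
          mm_comp _ _ _ _ _ _ _ (fun a ha => h2 (Ideal.mul_mem_left _ _ ha))]
        exact mm_congr _ _ _ _ (by ring) _) (by
        have : Q ≤ K := hKQ ▸ le_sup_left
        rw [mm_comp _ _ _ _ _ _ _ (mul_aux (this)), LinearMap.id_comp]
        exact mm_congr _ _ _ _ (by ring) _) (i + 1) z
    rw [Tm_id, hv] at this
    exact this.symm
  refine rk_exact 𝕜 (Tm P (i + 2) (mm J1 J2 x (fun a => (hJ a).2)))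
    (Tm P (i + 2) (pr J2 K (hKJ ▸ le_sup_left))) ?_ ?_ ?_
  · rw [injective_iff_map_eq_zero]
    intro z hz
    rw [exact_left P (mm_inj J1 J2 x hJ) (mm_exact J1 J2 x _ K hKJ) (pr_surj _ _ _) (i + 2)] at hz
    obtain ⟨w, rfl⟩ := hz
    exact hd _ _
  · exact exact_mid P (mm_inj J1 J2 x hJ) (mm_exact J1 J2 x _ K hKJ) (pr_surj _ _ _) (i + 2)
  · intro z
    exact (exact_right P (mm_inj J1 J2 x hJ) (mm_exact J1 J2 x _ K hKJ) (pr_surj _ _ _) (i + 1) z).1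
      (hd _ _)

lemma T_ring_sub (i : ℕ) : Subsingleton (T P (i + 1) R) :=
  ModuleCat.subsingleton_of_isZero (T_ring_succ P i)

lemma bt_shift (J : Ideal R) (i : ℕ) :
    bt 𝕜 P (i + 1) J = bt 𝕜 P (i + 2) (R ⧸ J) := by
  have hf : Function.Injective (Submodule.subtype J) := Subtype.val_injective
  have he : Function.Exact (Submodule.subtype J) (Submodule.mkQ J) := LinearMap.exact_subtype_mkQ J
  have hg := Submodule.mkQ_surjective J
  have s1 := T_ring_sub P i
  have s2 := T_ring_sub P (i + 1)
  refine (rk_bij 𝕜 (del P hf he hg (i + 1)) ⟨?_, ?_⟩).symm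
  · rw [injective_iff_map_eq_zero]
    intro z hz
    rw [exact_right P hf he hg (i + 1)] at hz
    obtain ⟨w, rfl⟩ := hz
    rw [Subsingleton.elim w 0, map_zero]
  · intro z
    exact (exact_left P hf he hg (i + 1) z).1 (Subsingleton.elim _ _)

lemma T_bot_sub (i : ℕ) (a : T P (i + 1) (R ⧸ (⊥ : Ideal R))) : a = 0 := by
  have s := T_ring_sub P i
  let e := Submodule.quotEquivOfEqBot (⊥ : Ideal R) rfl
  rw [← Tm_id P (i + 1) a, show (LinearMap.id : (R ⧸ (⊥ : Ideal R)) →ₗ[R] _) =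
    e.symm.toLinearMap ∘ₗ e.toLinearMap by simp, Tm_comp,
    Subsingleton.elim (Tm P (i + 1) e.toLinearMap a) 0, map_zero]

lemma bt_bot_succ (i : ℕ) : bt 𝕜 P (i + 1) (R ⧸ (⊥ : Ideal R)) = 0 := by
  have : Subsingleton (T P (i + 1) (R ⧸ (⊥ : Ideal R))) :=
    ⟨fun a b => by rw [T_bot_sub P i a, T_bot_sub P i b]⟩
  exact rk_subsingleton _

lemma bt_bot_zero : bt 𝕜 P 0 (R ⧸ (⊥ : Ideal R)) = rk (R := R) 𝕜 k := by
  obtain ⟨e'⟩ := T_ring_zero P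
  let e := Submodule.quotEquivOfEqBot (⊥ : Ideal R) rfl
  rw [← rk_bij 𝕜 e'.hom.hom (ConcreteCategory.bijective_of_isIso e'.hom)]
  refine rk_bij 𝕜 (Tm P 0 e.toLinearMap) (Function.bijective_iff_has_inverse.2
    ⟨Tm P 0 e.symm.toLinearMap, fun a => ?_, fun a => ?_⟩)
  · rw [← Tm_comp]; simp [Tm_id]
  · rw [← Tm_comp]; simp [Tm_id]

lemma bt_top (i : ℕ) (J : Ideal R) (hJ : J = ⊤) : bt 𝕜 P i (R ⧸ J) = 0 := by
  subst hJ
  have : Subsingleton (T P i (R ⧸ (⊤ : Ideal R))) := by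
    have key : ∀ a : T P i (R ⧸ (⊤ : Ideal R)), a = 0 := by
      intro a
      rw [← Tm_id P i a, Subsingleton.elim (LinearMap.id : (R ⧸ (⊤ : Ideal R)) →ₗ[R] _) 0, Tm_zero]
      rfl
    exact ⟨fun a b => by rw [key a, key b]⟩
  exact rk_subsingleton _

end Rank

section Monomial
variable {n : ℕ} {𝕜 : Type} [Field 𝕜]

/-- monomial ideal -/
noncomputable def MI (𝕜 : Type) [Field 𝕜] (U : Set (Fin n →₀ ℕ)) : Ideal (MvPolynomial (Fin n) 𝕜) :=
  Ideal.span ((fun s => monomial s (1 : 𝕜)) '' U)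

lemma mem_MI {U : Set (Fin n →₀ ℕ)} (hU : IsUpperSet U) (p : MvPolynomial (Fin n) 𝕜) :
    p ∈ MI 𝕜 U ↔ ∀ d, coeff d p ≠ 0 → d ∈ U := by
  rw [MI, mem_ideal_span_monomial_image]
  constructor
  · intro h d hd
    obtain ⟨s, hs, hsd⟩ := h d (mem_support_iff.2 hd)
    exact hU hsd hs
  · intro h d hd
    exact ⟨d, h d (mem_support_iff.1 hd), le_rfl⟩

lemma MI_colon {U V : Set (Fin n →₀ ℕ)} (hU : IsUpperSet U) (hV : IsUpperSet V) (d : Fin n →₀ ℕ)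
    (h : ∀ e, d + e ∈ U ↔ e ∈ V) (a : MvPolynomial (Fin n) 𝕜) :
    monomial d (1 : 𝕜) * a ∈ MI 𝕜 U ↔ a ∈ MI 𝕜 V := by
  rw [mem_MI hU, mem_MI hV]
  constructor
  · intro H e he
    rw [← h]
    apply H
    rw [coeff_monomial_mul', if_pos (le_self_add), one_mul, add_tsub_cancel_left]
    exact he
  · intro H e he
    rw [coeff_monomial_mul'] at he
    split_ifs at he with hd
    · rw [one_mul] at he
      have := (h _).2 (H _ he)
      rwa [add_tsub_cancel_of_le hd] at this
    · exact absurd rfl he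

lemma MI_sup {U W : Set (Fin n →₀ ℕ)} (d : Fin n →₀ ℕ)
    (hU : IsUpperSet U) (hW : IsUpperSet W) (h : ∀ e, e ∈ W ↔ e ∈ U ∨ d ≤ e) :
    MI 𝕜 W = MI 𝕜 U ⊔ Ideal.span {monomial d (1 : 𝕜)} := by
  have e1 : MI 𝕜 U ⊔ Ideal.span {monomial d (1 : 𝕜)} = MI 𝕜 (U ∪ {d}) := by
    rw [MI, MI, Set.image_union, Ideal.span_union, Set.image_singleton]
  rw [e1]
  ext p
  rw [mem_MI hW, MI, mem_ideal_span_monomial_image]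
  refine forall_congr' fun e => ?_
  rw [mem_support_iff]
  refine imp_congr Iff.rfl ?_
  rw [h]
  constructor
  · rintro (he | he)
    · exact ⟨e, Or.inl he, le_rfl⟩
    · exact ⟨d, Or.inr rfl, he⟩
  · rintro ⟨s, hs | hs, hse⟩
    · exact Or.inl (hU hse hs)
    · rw [Set.mem_singleton_iff] at hs
      exact Or.inr (hs ▸ hse)

lemma MI_mono {U V : Set (Fin n →₀ ℕ)} (h : U ⊆ V) : MI 𝕜 U ≤ MI 𝕜 V :=
  Ideal.span_mono (Set.image_mono h)

/-- exponents of the complete intersection ideals -/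
def UC (e : Fin n → ℕ) (S : Finset (Fin n)) : Set (Fin n →₀ ℕ) := {d | ∃ i ∈ S, e i ≤ d i}

lemma UC_upper (e : Fin n → ℕ) (S : Finset (Fin n)) : IsUpperSet (UC e S) := by
  rintro a b hab ⟨i, hi, h⟩
  exact ⟨i, hi, h.trans (hab i)⟩

lemma UC_empty (e : Fin n → ℕ) : MI 𝕜 (UC e ∅) = ⊥ := by
  simp [MI, UC]

lemma UC_insert (e : Fin n → ℕ) (S : Finset (Fin n)) (a : Fin n) :
    MI 𝕜 (UC e (insert a S)) =
      MI 𝕜 (UC e S) ⊔ Ideal.span {monomial (Finsupp.single a (e a)) (1 : 𝕜)} := by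
  apply MI_sup _ (UC_upper _ _) (UC_upper _ _)
  intro d
  simp only [UC, Set.mem_setOf_eq, Finset.mem_insert, exists_eq_or_imp, Finsupp.single_le_iff]
  exact or_comm

lemma UC_reg (e : Fin n → ℕ) (S : Finset (Fin n)) (a : Fin n) (ha : a ∉ S) (c : ℕ)
    (p : MvPolynomial (Fin n) 𝕜) :
    monomial (Finsupp.single a c) (1 : 𝕜) * p ∈ MI 𝕜 (UC e S) ↔ p ∈ MI 𝕜 (UC e S) := by
  apply MI_colon (UC_upper _ _) (UC_upper _ _)
  intro d
  simp only [UC, Set.mem_setOf_eq]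
  refine exists_congr fun i => and_congr_right fun hi => ?_
  have : a ≠ i := fun h => ha (h ▸ hi)
  simp [Finsupp.single_apply, this]

/-- residue field -/
noncomputable abbrev kk (n : ℕ) (𝕜 : Type) [Field 𝕜] : ModuleCat.{0} (MvPolynomial (Fin n) 𝕜) :=
  ModuleCat.of _ (MvPolynomial (Fin n) 𝕜 ⧸
    Ideal.span (Set.range (X : Fin n → MvPolynomial (Fin n) 𝕜)))

lemma kk_smul (a : Fin n) (c : ℕ) (hc : 1 ≤ c) (u : kk n 𝕜) :
    monomial (Finsupp.single a c) (1 : 𝕜) • u = 0 := by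
  obtain ⟨v, rfl⟩ := Submodule.Quotient.mk_surjective _ u
  rw [← Submodule.Quotient.mk_smul, Submodule.Quotient.mk_eq_zero, ← X_pow_eq_monomial, smul_eq_mul]
  apply Ideal.mul_mem_right
  have hX : (X a : MvPolynomial (Fin n) 𝕜) ∈ Ideal.span (Set.range (X : Fin n → MvPolynomial (Fin n) 𝕜)) :=
    Ideal.subset_span (Set.mem_range_self a)
  exact Ideal.pow_mem_of_mem _ hX _ hc

lemma kk_rank : rk (R := MvPolynomial (Fin n) 𝕜) 𝕜 (kk n 𝕜) = 1 := by
  have hm : ∀ p : MvPolynomial (Fin n) 𝕜,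
      p ∈ Ideal.span (Set.range (X : Fin n → MvPolynomial (Fin n) 𝕜)) ↔ coeff 0 p = 0 := by
    intro p
    rw [← Set.image_univ, mem_ideal_span_X_image]
    constructor
    · intro h
      by_contra h0
      obtain ⟨i, _, hi⟩ := h 0 (mem_support_iff.2 h0)
      simp at hi
    · intro h d hd
      by_contra hc
      push Not at hc
      have : d = 0 := by ext i; simpa using hc i
      rw [mem_support_iff, this] at hd
      exact hd h
  apply rk_one 𝕜 (Submodule.Quotient.mk 1)
  · rw [Ne, Submodule.Quotient.mk_eq_zero, hm]
    simp
  · intro w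
    obtain ⟨v, rfl⟩ := Submodule.Quotient.mk_surjective _ w
    refine ⟨coeff 0 v, ?_⟩
    rw [← Submodule.Quotient.mk_smul, Submodule.Quotient.eq, hm]
    simp [algebraMap_eq]

variable (P : ProjectiveResolution (kk n 𝕜))

lemma bt_UC (e : Fin n → ℕ) (S : Finset (Fin n)) (he : ∀ i ∈ S, 1 ≤ e i) :
    ∀ i, bt 𝕜 P i (MvPolynomial (Fin n) 𝕜 ⧸ MI 𝕜 (UC e S)) = (S.card.choose i : ℕ) := by
  classical
  induction S using Finset.induction_on with
  | empty =>
    rw [UC_empty]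
    intro i
    rcases i with _ | i
    · rw [bt_bot_zero, kk_rank]; simp
    · rw [bt_bot_succ]; simp
  | insert a S ha ih =>
    have ih := ih (fun i hi => he i (Finset.mem_insert_of_mem hi))
    have hx := kk_smul (𝕜 := 𝕜) a (e a) (he a (Finset.mem_insert_self _ _))
    intro i
    rcases i with _ | i
    · rw [bt_reg_zero 𝕜 P _ _ hx (UC_reg e S a ha _) _ (UC_insert e S a), ih]; simp
    · rw [bt_reg_succ 𝕜 P _ _ hx (UC_reg e S a ha _) _ (UC_insert e S a), ih, ih,
        Finset.card_insert_of_notMem ha, Nat.choose_succ_succ, Nat.cast_add, add_comm]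

lemma UC_le (m : ℕ) (S : Finset (Fin n)) :
    MI 𝕜 (UC (fun _ => m + 1) S) ≤ MI 𝕜 (UC (fun _ => m) S) := by
  apply MI_mono
  rintro d ⟨i, hi, h⟩
  exact ⟨i, hi, (Nat.le_succ m).trans h⟩

lemma UC_vanish (m : ℕ) (S : Finset (Fin n)) (i : ℕ) :
    Tm P (i + 1) (pr _ _ (UC_le (𝕜 := 𝕜) m S)) = 0 := by
  classical
  induction S using Finset.induction_on with
  | empty =>
    have key : ∀ (I I' : Ideal (MvPolynomial (Fin n) 𝕜)) (h : I ≤ I') (_ : I = ⊥),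
        Tm P (i + 1) (pr I I' h) = 0 := by
      intro I I' h hI
      subst hI
      ext z
      rw [T_bot_sub P i z, map_zero, map_zero]
    exact key _ _ _ (UC_empty _)
  | insert a S ha ih =>
    have e : monomial (Finsupp.single a (m + 1)) (1 : 𝕜) =
        monomial (Finsupp.single a 1) (1 : 𝕜) * monomial (Finsupp.single a m) (1 : 𝕜) := by
      rw [monomial_mul, ← Finsupp.single_add, add_comm, one_mul]
    refine vanish_step P _ _ (UC_le m S) (monomial (Finsupp.single a m) (1 : 𝕜))
      (monomial (Finsupp.single a 1) (1 : 𝕜)) (kk_smul a 1 le_rfl) (UC_reg _ S a ha _) ?_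
      _ _ ?_ (UC_insert _ S a) _ i ih
    · rw [← e]; exact UC_reg _ S a ha _
    · rw [← e]; exact UC_insert _ S a

/-- exponents of `J` -/
def UJ (z : Fin n) (m : ℕ) : Set (Fin n →₀ ℕ) := {d | ∃ j, j ≠ z ∧ m ≤ d z + d j}

lemma UJ_upper (z : Fin n) (m : ℕ) : IsUpperSet (UJ z m) := by
  rintro a b hab ⟨i, hi, h⟩
  exact ⟨i, hi, h.trans (add_le_add (hab z) (hab i))⟩

lemma bt_UJ (z w : Fin n) (hzw : w ≠ z) (m i : ℕ) :
    bt 𝕜 P (i + 2) (MvPolynomial (Fin n) 𝕜 ⧸ MI 𝕜 (UJ z m)) = ((m * n.choose (i + 2) : ℕ)) := by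
  classical
  induction m with
  | zero =>
    rw [bt_top]
    · simp
    · rw [Ideal.eq_top_iff_one, mem_MI (UJ_upper _ _)]
      intro d _
      exact ⟨w, hzw, Nat.zero_le _⟩
  | succ m ih =>
    have h1 : MI 𝕜 (UC (fun _ => m) (Finset.univ.erase z)) ≤ MI 𝕜 (UJ z m) := by
      apply MI_mono
      rintro d ⟨j, hj, h⟩
      exact ⟨j, Finset.ne_of_mem_erase hj, h.trans (Nat.le_add_left _ _)⟩
    have h2 : MI 𝕜 (UC (fun _ => m + 1) (Finset.univ.erase z)) ≤ MI 𝕜 (UJ z (m + 1)) := by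
      apply MI_mono
      rintro d ⟨j, hj, h⟩
      exact ⟨j, Finset.ne_of_mem_erase hj, h.trans (Nat.le_add_left _ _)⟩
    have h3 := (UC_le m (Finset.univ.erase z)).trans h1
    rw [bt_step 𝕜 P (MI 𝕜 (UC (fun _ => m + 1) (Finset.univ.erase z))) (MI 𝕜 (UJ z m))
      (MI 𝕜 (UJ z (m + 1))) (MI 𝕜 (UC (fun i => if i = z then 1 else m + 1) Finset.univ))
      (monomial (Finsupp.single z 1) (1 : 𝕜)) (UC_reg _ _ z (by simp) _) ?_ ?_ ?_ h3 h2, ih, bt_UC]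
    · rw [Finset.card_univ, Fintype.card_fin, ← Nat.cast_add]
      congr 1
      ring
    · intro i _
      split_ifs <;> omega
    · intro i
      have e : pr _ _ h3 = pr _ _ h1 ∘ₗ pr _ _ (UC_le m (Finset.univ.erase z)) := by
        rw [mm_comp _ _ _ _ _ _ _ (mul_aux h3)]
        exact mm_congr _ _ _ _ (by ring) _
      ext x
      rw [e, Tm_comp, UC_vanish, LinearMap.zero_apply, map_zero, LinearMap.zero_apply]
    · apply MI_colon (UJ_upper _ _) (UJ_upper _ _)
      intro d
      simp only [UJ, Set.mem_setOf_eq]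
      refine exists_congr fun j => and_congr_right fun hj => ?_
      simp [Finsupp.single_apply, hj.symm]
      omega
    · apply MI_sup _ (UC_upper _ _) (UC_upper _ _)
      intro d
      simp only [UC, Set.mem_setOf_eq, Finset.mem_univ, true_and, Finsupp.single_le_iff,
        Finset.mem_erase, and_true]
      constructor
      · rintro ⟨j, hj⟩
        by_cases hjz : j = z
        · subst hjz; right; simpa using hj
        · left; exact ⟨j, hjz, by simpa [hjz] using hj⟩
      · rintro (⟨j, hjz, hj⟩ | h)
        · exact ⟨j, by simpa [hjz] using hj⟩
        · exact ⟨z, by simpa using h⟩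
    · apply MI_sup _ (UJ_upper _ _) (UC_upper _ _)
      intro d
      simp only [UC, UJ, Set.mem_setOf_eq, Finset.mem_univ, true_and, Finsupp.single_le_iff]
      constructor
      · rintro ⟨j, hj⟩
        by_cases hjz : j = z
        · subst hjz; right; simpa using hj
        · left; exact ⟨j, hjz, by simp [hjz] at hj; omega⟩
      · rintro (⟨j, hjz, hj⟩ | h)
        · by_cases h0 : 1 ≤ d z
          · exact ⟨z, by simpa using h0⟩
          · exact ⟨j, by simp [hjz]; omega⟩
        · exact ⟨z, by simpa using h⟩

lemma choose_sum (n i : ℕ) (hn : 1 ≤ n) (hi : 1 ≤ i) :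
    ∑ j ∈ Finset.Icc 2 n, Nat.choose (1 + n - j) i = n.choose (i + 1) := by
  have h2 : ∀ N, ∑ s ∈ Finset.range (N + 1), Nat.choose s i = (N + 1).choose (i + 1) := by
    intro N
    induction N with
    | zero => rw [Finset.sum_range_one, Nat.choose_eq_zero_of_lt (by omega),
        Nat.choose_eq_zero_of_lt (by omega)]
    | succ N ih => rw [Finset.sum_range_succ, ih, Nat.choose_succ_succ (N + 1) i, add_comm]
  obtain ⟨N, rfl⟩ : ∃ N, n = N + 1 := ⟨n - 1, by omega⟩
  rw [← h2 N, Finset.sum_range_succ', Nat.choose_eq_zero_of_lt (show 0 < i by omega), add_zero]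
  refine Finset.sum_nbij' (fun j => N + 1 - j) (fun s => N + 1 - s) ?_ ?_ ?_ ?_ ?_
  · intro j hj; simp at hj ⊢; omega
  · intro j hj; simp at hj ⊢; omega
  · intro j hj; simp at hj ⊢; omega
  · intro j hj; simp at hj ⊢; omega
  · intro j hj
    simp at hj
    congr 1
    omega

lemma J_eq (m : ℕ) (hn : 2 ≤ n) (z : Fin n) (hz : z = ⟨0, by omega⟩) :
    Ideal.span { f | (∃ i : Fin n, f = monomial (Finsupp.single i m) (1 : 𝕜)) ∨
      (∃ (j : Fin n) (k : ℕ), 1 ≤ j.val ∧ 1 ≤ k ∧ k ≤ m - 1 ∧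
        f = monomial (Finsupp.single z (m - k) + Finsupp.single j k)
          (1 : 𝕜)) } = MI 𝕜 (UJ z m) := by
  have hw : ∃ w : Fin n, w ≠ z := ⟨⟨1, by omega⟩, by rw [hz]; simp [Fin.ext_iff]⟩
  have e : { f | (∃ i : Fin n, f = monomial (Finsupp.single i m) (1 : 𝕜)) ∨
      (∃ (j : Fin n) (k : ℕ), 1 ≤ j.val ∧ 1 ≤ k ∧ k ≤ m - 1 ∧
        f = monomial (Finsupp.single z (m - k) + Finsupp.single j k)
          (1 : 𝕜)) } = (fun s => monomial s (1 : 𝕜)) '' {d | (∃ i : Fin n, d = Finsupp.single i m) ∨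
      (∃ (j : Fin n) (k : ℕ), 1 ≤ j.val ∧ 1 ≤ k ∧ k ≤ m - 1 ∧
        d = Finsupp.single z (m - k) + Finsupp.single j k)} := by
    ext f
    constructor
    · rintro (⟨i, rfl⟩ | ⟨j, k, h1, h2, h3, rfl⟩)
      · exact ⟨_, Or.inl ⟨i, rfl⟩, rfl⟩
      · exact ⟨_, Or.inr ⟨j, k, h1, h2, h3, rfl⟩, rfl⟩
    · rintro ⟨d, ⟨i, rfl⟩ | ⟨j, k, h1, h2, h3, rfl⟩, rfl⟩
      · exact Or.inl ⟨i, rfl⟩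
      · exact Or.inr ⟨j, k, h1, h2, h3, rfl⟩
  have hjz : ∀ j : Fin n, j ≠ z ↔ 1 ≤ j.val := by
    intro j
    rw [hz, Ne, Fin.ext_iff]
    simp only
    omega
  rw [e]
  ext p
  rw [mem_MI (UJ_upper _ _), mem_ideal_span_monomial_image]
  refine forall_congr' fun d => ?_
  rw [mem_support_iff]
  refine imp_congr Iff.rfl ?_
  constructor
  · rintro ⟨s, ⟨i, rfl⟩ | ⟨j, k, h1, h2, h3, rfl⟩, hs⟩
    · rw [Finsupp.single_le_iff] at hs
      by_cases hi : i = z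
      · obtain ⟨w, hw⟩ := hw
        subst hi
        exact ⟨w, hw, by omega⟩
      · exact ⟨i, hi, by omega⟩
    · have hj := (hjz j).2 h1
      refine ⟨j, hj, ?_⟩
      have a1 := hs z
      have a2 := hs j
      simp [Finsupp.single_apply, hj, hj.symm] at a1 a2
      omega
  · rintro ⟨j, hj, h⟩
    by_cases c1 : m ≤ d z
    · exact ⟨_, Or.inl ⟨z, rfl⟩, Finsupp.single_le_iff.2 c1⟩
    by_cases c2 : m ≤ d j
    · exact ⟨_, Or.inl ⟨j, rfl⟩, Finsupp.single_le_iff.2 c2⟩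
    refine ⟨_, Or.inr ⟨j, d j, (hjz j).1 hj, by omega, by omega, rfl⟩, ?_⟩
    intro i
    rw [Finsupp.add_apply, Finsupp.single_apply, Finsupp.single_apply]
    split_ifs with q1 q2 q2
    · exact absurd (q2.trans q1.symm) hj
    · subst q1; omega
    · subst q2; omega
    · omega

end Monomial
end BettiAux

/-- Proposition 3.3 (Betti numbers of `J_{n,m}`, with `y_i = X (i-1)`):
for `1 ≤ i ≤ n−1`,
`β_i(J_{n,m}) = C(n−1,i) + Σ_{j=2}^{n} (m−1)·C(1+n−j,i) + C(n−1,i+1)`,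
and `β_i(J_{n,m}) = 0` for `i ≥ n`; in particular `projdim(J_{n,m}) = n−1`. -/
theorem stmt4 {𝕜 : Type} [Field 𝕜] (n m : ℕ) (hn : 2 ≤ n) (hm : 1 ≤ m)
    (J : Ideal (MvPolynomial (Fin n) 𝕜))
    (hJ : J = Ideal.span { f | (∃ i : Fin n, f = monomial (Finsupp.single i m) (1 : 𝕜)) ∨
      (∃ (j : Fin n) (k : ℕ), 1 ≤ j.val ∧ 1 ≤ k ∧ k ≤ m - 1 ∧
        f = monomial (Finsupp.single (⟨0, by omega⟩ : Fin n) (m - k) + Finsupp.single j k)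
          (1 : 𝕜)) }) :
    (∀ i : ℕ, 1 ≤ i → i ≤ n - 1 →
      betti 𝕜 J i = ((Nat.choose (n - 1) i +
        (∑ j ∈ Finset.Icc 2 n, (m - 1) * Nat.choose (1 + n - j) i) +
        Nat.choose (n - 1) (i + 1) : ℕ) : Cardinal)) ∧
    ∀ i : ℕ, n ≤ i → betti 𝕜 J i = 0 := by
  classical
  have hP : ∃ P : ProjectiveResolution (BettiAux.kk n 𝕜), True := ⟨ProjectiveResolution.of _, trivial⟩
  obtain ⟨P, -⟩ := hP
  have hJ' : J = BettiAux.MI 𝕜 (BettiAux.UJ (⟨0, by omega⟩ : Fin n) m) := by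
    rw [hJ]
    exact BettiAux.J_eq m hn _ rfl
  have key : ∀ i, betti 𝕜 J (i + 1) = ((m * n.choose (i + 2) : ℕ) : Cardinal) := by
    intro i
    have h1 : betti 𝕜 J (i + 1) = BettiAux.bt 𝕜 P (i + 1) J :=
      BettiAux.rk_bij 𝕜 (BettiAux.torIso P (i + 1) J).hom.hom
        (ConcreteCategory.bijective_of_isIso (BettiAux.torIso P (i + 1) J).hom)
    rw [h1, BettiAux.bt_shift, hJ']
    exact BettiAux.bt_UJ P _ (⟨1, by omega⟩ : Fin n) (by simp [Fin.ext_iff]) m i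
  constructor
  · intro i hi _
    obtain ⟨i, rfl⟩ : ∃ j, i = j + 1 := ⟨i - 1, by omega⟩
    rw [key i, ← Finset.mul_sum, BettiAux.choose_sum n (i + 1) (by omega) (by omega)]
    congr 1
    obtain ⟨N, rfl⟩ : ∃ N, n = N + 1 := ⟨n - 1, by omega⟩
    obtain ⟨M, rfl⟩ : ∃ M, m = M + 1 := ⟨m - 1, by omega⟩
    rw [Nat.add_sub_cancel, Nat.add_sub_cancel, Nat.choose_succ_succ N (i + 1)]
    ring
  · intro i hi
    obtain ⟨i, rfl⟩ : ∃ j, i = j + 1 := ⟨i - 1, by omega⟩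
    rw [key i, Nat.choose_eq_zero_of_lt (by omega)]
    simp
end

section
/- Let m ≥ 3 and let I_m = ⟨ x_{i,1}^3 x_{i,2} (1 ≤ i ≤ m), x_{i,1}^2 x_{i+1,1} x_{i+1,2} (1 ≤ i ≤ m, with the first index taken cyclically modulo m) ⟩ ⊆ k[x_{1,1},x_{1,2},…,x_{m,1},x_{m,2}]. Then projdim(I_m) = ⌊m/2⌋ + m − 1; that is, β_{⌊m/2⌋+m−1}(I_m) ≠ 0 and β_i(I_m) = 0 for every i > ⌊m/2⌋ + m − 1. -/
open MvPolynomial CategoryTheory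

section Homological
open CategoryTheory.Limits MonoidalCategory

variable {R : Type} [CommRing R] (N : ModuleCat.{0} R)

/-- The complex `A ⊗ Q` for `Q` a projective resolution of `N`. -/
noncomputable abbrev torCx (A : ModuleCat.{0} R) : ChainComplex (ModuleCat.{0} R) ℕ :=
  (((tensoringLeft (ModuleCat.{0} R)).obj A).mapHomologicalComplex _).obj
    (projectiveResolution N).complex

noncomputable abbrev torCxMap {A B : ModuleCat.{0} R} (f : A ⟶ B) : torCx N A ⟶ torCx N B :=
  (NatTrans.mapHomologicalComplex ((tensoringLeft (ModuleCat.{0} R)).map f) _).app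
    (projectiveResolution N).complex

/-- vanishing of `Tor_i(A, N)` -/
def TZ (A : Type) [AddCommGroup A] [Module R A] (i : ℕ) : Prop :=
  IsZero ((torCx N (ModuleCat.of R A)).homology i)

lemma TZ_iff_tor (A : Type) [AddCommGroup A] [Module R A] (i : ℕ) :
    TZ N A i ↔ IsZero (((Tor (ModuleCat R) i).obj (ModuleCat.of R A)).obj N) :=
  ((projectiveResolution N).isoLeftDerivedObj
    ((tensoringLeft (ModuleCat R)).obj (ModuleCat.of R A)) i).symm.isZero_iff

section ses
variable {A B C : Type} [AddCommGroup A] [AddCommGroup B] [AddCommGroup C]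
  [Module R A] [Module R B] [Module R C]
  (f : A →ₗ[R] B) (g : B →ₗ[R] C) (hf : Function.Injective f) (hg : Function.Surjective g)
  (hfg : Function.Exact f g)

noncomputable def torSC (hfg : Function.Exact f g) :
    ShortComplex (ChainComplex (ModuleCat.{0} R) ℕ) :=
  ShortComplex.mk (torCxMap N (ModuleCat.ofHom f)) (torCxMap N (ModuleCat.ofHom g)) (by
    ext i : 1
    have h : ModuleCat.ofHom f ≫ ModuleCat.ofHom g = 0 := by
      ext x
      exact hfg.apply_apply_eq_zero x
    change (ModuleCat.ofHom f ▷ (projectiveResolution N).complex.X i) ≫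
      (ModuleCat.ofHom g ▷ (projectiveResolution N).complex.X i) = 0
    rw [← comp_whiskerRight, h, MonoidalPreadditive.zero_whiskerRight])

include hf hg in
lemma torSC_shortExact : (torSC N f g hfg).ShortExact := by
  apply HomologicalComplex.shortExact_of_degreewise_shortExact
  intro i
  have : Projective ((projectiveResolution N).complex.X i) := inferInstance
  have : Module.Projective R ((projectiveResolution N).complex.X i) :=
    (IsProjective.iff_projective _).mpr this
  have hfl : Module.Flat R ((projectiveResolution N).complex.X i) := inferInstance
  refine { exact := ?_, mono_f := ?_, epi_g := ?_ }
  · rw [ShortComplex.ShortExact.moduleCat_exact_iff_function_exact]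
    exact rTensor_exact _ hfg hg
  · rw [ModuleCat.mono_iff_injective]
    exact Module.Flat.rTensor_preserves_injective_linearMap f hf
  · rw [ModuleCat.epi_iff_surjective]
    exact LinearMap.rTensor_surjective _ hg

include hf hg hfg

lemma TZ_mid {i : ℕ} (hA : TZ N A i) (hC : TZ N C i) : TZ N B i :=
  ((torSC_shortExact N f g hf hg hfg).homology_exact₂ i).isZero_of_both_zeros
    (hA.eq_of_src _ _) (hC.eq_of_tgt _ _)

lemma TZ_right {i : ℕ} (hB : TZ N B (i + 1)) (hA : TZ N A i) : TZ N C (i + 1) :=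
  ((torSC_shortExact N f g hf hg hfg).homology_exact₃ (i + 1) i rfl).isZero_of_both_zeros
    (hB.eq_of_src _ _) (hA.eq_of_tgt _ _)

lemma TZ_left {i : ℕ} (hC : TZ N C (i + 1)) (hB : TZ N B i) : TZ N A i :=
  ((torSC_shortExact N f g hf hg hfg).homology_exact₁ (i + 1) i rfl).isZero_of_both_zeros
    (hC.eq_of_src _ _) (hB.eq_of_tgt _ _)

lemma TZ_left' {i : ℕ} (hC : TZ N C (i + 1))
    (h0 : HomologicalComplex.homologyMap (torCxMap N (ModuleCat.ofHom f)) i = 0) : TZ N A i :=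
  ((torSC_shortExact N f g hf hg hfg).homology_exact₁ (i + 1) i rfl).isZero_of_both_zeros
    (hC.eq_of_src _ _) h0

end ses

lemma torCxMap_smul (A : Type) [AddCommGroup A] [Module R A] (x : R)
    (hx : ∀ n : N, x • n = 0) (f : A →ₗ[R] A) (hf : ∀ a, f a = x • a) (i : ℕ) :
    HomologicalComplex.homologyMap (torCxMap N (ModuleCat.ofHom f)) i = 0 := by
  have e : torCxMap N (ModuleCat.ofHom f) =
    (((tensoringLeft (ModuleCat.{0} R)).obj (ModuleCat.of R A)).mapHomologicalComplex _).map
      (x • 𝟙 (projectiveResolution N).complex) := by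
    ext i : 1
    change (ModuleCat.ofHom f ▷ (projectiveResolution N).complex.X i) = 
      ModuleCat.of R A ◁ (x • 𝟙 ((projectiveResolution N).complex.X i))
    apply ModuleCat.hom_ext
    apply TensorProduct.ext'
    intro a b
    change f a ⊗ₜ[R] b = a ⊗ₜ[R] (x • b)
    rw [hf, TensorProduct.smul_tmul]
  have hh : Homotopy (x • 𝟙 (projectiveResolution N).complex) 0 := by
    refine ProjectiveResolution.liftHomotopyZero (P := projectiveResolution N)
      (Q := projectiveResolution N) _ ?_
    have h0 : x • 𝟙 N = 0 := by ext n; exact hx n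
    have h1 : (x • 𝟙 (projectiveResolution N).complex) ≫ (projectiveResolution N).π =
        (projectiveResolution N).π ≫ (ChainComplex.single₀ (ModuleCat R)).map (x • 𝟙 N) := by
      ext : 1
      change (x • 𝟙 _) ≫ (projectiveResolution N).π.f 0 = (projectiveResolution N).π.f 0 ≫ _
      rw [ChainComplex.single₀_map_f_zero]
      apply ModuleCat.hom_ext
      ext n
      exact map_smul ((projectiveResolution N).π.f 0).hom x n
    rw [h1, h0]
    simp
  have := ((((tensoringLeft (ModuleCat.{0} R)).obj (ModuleCat.of R A)).mapHomotopy hh).homologyMap_eq i)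
  rw [e]
  refine this.trans ?_
  rw [Functor.map_zero]
  exact HomologicalComplex.homologyMap_zero _ _ _

lemma TZ_self_iff (i : ℕ) : TZ N R i ↔ IsZero ((projectiveResolution N).complex.homology i) := by
  let e : (tensoringLeft (ModuleCat.{0} R)).obj (ModuleCat.of R R) ≅ 𝟭 _ :=
    leftUnitorNatIso (ModuleCat.{0} R)
  let e2 := ((NatIso.mapHomologicalComplex e (ComplexShape.down ℕ)) ≪≫
    Functor.mapHomologicalComplexIdIso _ _).app (projectiveResolution N).complex
  exact ((HomologicalComplex.homologyFunctor _ _ i).mapIso e2).isZero_iff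

lemma TZ_self_succ (i : ℕ) : TZ N R (i + 1) := by
  rw [TZ_self_iff]
  exact ((projectiveResolution N).complex_exactAt_succ i).isZero_homology

lemma not_TZ_self_zero [Nontrivial N] : ¬ TZ N R 0 := by
  rw [TZ_self_iff]
  intro h
  have e : (projectiveResolution N).complex.homology 0 ≅ N :=
    isoOfQuasiIsoAt (projectiveResolution N).π 0 ≪≫
    (HomologicalComplex.homologyFunctorSingleIso (ModuleCat R) (ComplexShape.down ℕ) 0).app N
  have := ModuleCat.subsingleton_of_isZero (e.isZero_iff.mp h)
  exact not_subsingleton N this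

end Homological

section Ideals
variable {R : Type} [CommRing R] (N : ModuleCat.{0} R)

/-- multiplication by `x` from `R/(J:x)` to `R/J` -/
noncomputable def colonMap (J' J : Ideal R) (x : R) (h1 : ∀ r, r ∈ J' ↔ x * r ∈ J) :
    (R ⧸ J') →ₗ[R] (R ⧸ J) :=
  Submodule.mapQ J' J (LinearMap.mulLeft R x) (fun r hr => (h1 r).1 hr)

lemma colon_ses (J' J J'' : Ideal R) (x : R) (h1 : ∀ r, r ∈ J' ↔ x * r ∈ J)
    (h2 : J'' = J ⊔ Ideal.span {x}) :
    ∃ g : (R ⧸ J) →ₗ[R] (R ⧸ J''), Function.Injective (colonMap J' J x h1) ∧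
      Function.Surjective g ∧ Function.Exact (colonMap J' J x h1) g := by
  have hle : J ≤ J'' := h2 ▸ le_sup_left
  refine ⟨Submodule.mapQ J J'' LinearMap.id hle, ?_, ?_, ?_⟩
  · rw [injective_iff_map_eq_zero]
    intro a
    obtain ⟨r, rfl⟩ := Submodule.Quotient.mk_surjective _ a
    intro h
    have h' : (Submodule.Quotient.mk (x * r) : R ⧸ J) = 0 := h
    rw [Submodule.Quotient.mk_eq_zero] at h' ⊢
    exact (h1 r).2 h'
  · intro a
    obtain ⟨r, rfl⟩ := Submodule.Quotient.mk_surjective _ a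
    exact ⟨Submodule.Quotient.mk r, rfl⟩
  · intro a
    obtain ⟨r, rfl⟩ := Submodule.Quotient.mk_surjective _ a
    constructor
    · intro h
      have h' : (Submodule.Quotient.mk r : R ⧸ J'') = 0 := h
      rw [Submodule.Quotient.mk_eq_zero, h2, Submodule.mem_sup] at h'
      obtain ⟨y, hy, z, hz, rfl⟩ := h'
      obtain ⟨s, rfl⟩ := Ideal.mem_span_singleton'.1 hz
      refine ⟨Submodule.Quotient.mk s, ?_⟩
      change (Submodule.Quotient.mk (x * s) : R ⧸ J) = _
      rw [Submodule.Quotient.eq]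
      have : x * s - (y + s * x) = -y := by ring
      rw [this]
      exact J.neg_mem hy
    · rintro ⟨b, hb⟩
      obtain ⟨s, rfl⟩ := Submodule.Quotient.mk_surjective _ b
      rw [← hb]
      change (Submodule.Quotient.mk (x * s) : R ⧸ J'') = 0
      rw [Submodule.Quotient.mk_eq_zero, h2]
      exact Ideal.mul_mem_right _ _ (Ideal.mem_sup_right (Ideal.mem_span_singleton_self x))

end Ideals

section Mono
variable {𝕜 : Type} [Field 𝕜] {σ : Type} (N : ModuleCat.{0} (MvPolynomial σ 𝕜))

/-- monomial ideal spanned by a set of exponents -/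
noncomputable def mi (𝕜 : Type) [Field 𝕜] {σ : Type} (U : Set (σ →₀ ℕ)) :
    Ideal (MvPolynomial σ 𝕜) :=
  Ideal.span ((fun s => monomial s (1 : 𝕜)) '' U)

lemma mem_mi {U : Set (σ →₀ ℕ)} (hU : IsUpperSet U) (f : MvPolynomial σ 𝕜) :
    f ∈ mi 𝕜 U ↔ ∀ α ∈ f.support, α ∈ U := by
  rw [mi, mem_ideal_span_monomial_image]
  refine forall₂_congr fun α _ => ⟨fun ⟨s, hs, h⟩ => hU h hs, fun h => ⟨α, h, le_rfl⟩⟩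

/-- vanishing of `Tor_i(R/I_U, N)` -/
def TU (U : Set (σ →₀ ℕ)) (i : ℕ) : Prop := TZ N (MvPolynomial σ 𝕜 ⧸ mi 𝕜 U) i

/-- colon -/
def col (U : Set (σ →₀ ℕ)) (w : σ →₀ ℕ) : Set (σ →₀ ℕ) := {α | α + w ∈ U}

lemma col_upper {U : Set (σ →₀ ℕ)} (hU : IsUpperSet U) (w : σ →₀ ℕ) : IsUpperSet (col U w) :=
  fun _ _ h ha => hU (by gcongr) ha

lemma mi_col {U : Set (σ →₀ ℕ)} (hU : IsUpperSet U) (w : σ →₀ ℕ) (r : MvPolynomial σ 𝕜) :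
    r ∈ mi 𝕜 (col U w) ↔ monomial w 1 * r ∈ mi 𝕜 U := by
  rw [mem_mi (col_upper hU w), mem_mi hU]
  constructor
  · intro h α hα
    rw [mem_support_iff, coeff_monomial_mul'] at hα
    split_ifs at hα with hw
    · have := h (α - w) (by rw [mem_support_iff]; simpa using hα)
      rw [col, Set.mem_ofPred_eq, tsub_add_cancel_of_le hw] at this
      exact this
    · exact absurd rfl hα
  · intro h α hα
    refine h _ ?_
    rw [mem_support_iff, add_comm, coeff_monomial_mul]
    simpa using hα

lemma mi_sup (U : Set (σ →₀ ℕ)) (w : σ →₀ ℕ) :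
    mi 𝕜 (U ∪ Set.Ici w) = mi 𝕜 U ⊔ Ideal.span {monomial w 1} := by
  rw [mi, Set.image_union, Ideal.span_union, mi]
  congr 1
  apply le_antisymm
  · rw [Ideal.span_le]
    rintro _ ⟨α, hα, rfl⟩
    rw [SetLike.mem_coe, Ideal.mem_span_singleton]
    refine ⟨monomial (α - w) 1, ?_⟩
    simp [monomial_mul, add_tsub_cancel_of_le (Set.mem_Ici.1 hα)]
  · rw [Ideal.span_le, Set.singleton_subset_iff]
    exact Ideal.subset_span ⟨w, Set.mem_Ici.2 le_rfl, rfl⟩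

lemma TU_mid {U : Set (σ →₀ ℕ)} (hU : IsUpperSet U) (w : σ →₀ ℕ) {i : ℕ}
    (h1 : TU N (col U w) i) (h2 : TU N (U ∪ Set.Ici w) i) : TU N U i := by
  obtain ⟨g, a, b, c⟩ := colon_ses _ _ _ _ (mi_col (𝕜 := 𝕜) hU w) (mi_sup U w)
  exact TZ_mid N _ g a b c h1 h2

lemma TU_right {U : Set (σ →₀ ℕ)} (hU : IsUpperSet U) (w : σ →₀ ℕ) {i : ℕ}
    (h1 : TU N U (i + 1)) (h2 : TU N (col U w) i) : TU N (U ∪ Set.Ici w) (i + 1) := by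
  obtain ⟨g, a, b, c⟩ := colon_ses _ _ _ _ (mi_col (𝕜 := 𝕜) hU w) (mi_sup U w)
  exact TZ_right N _ g a b c h1 h2

lemma TU_left {U : Set (σ →₀ ℕ)} (hU : IsUpperSet U) (w : σ →₀ ℕ) {i : ℕ}
    (h1 : TU N (U ∪ Set.Ici w) (i + 1)) (h2 : TU N U i) : TU N (col U w) i := by
  obtain ⟨g, a, b, c⟩ := colon_ses _ _ _ _ (mi_col (𝕜 := 𝕜) hU w) (mi_sup U w)
  exact TZ_left N _ g a b c h1 h2

lemma TU_left' {U : Set (σ →₀ ℕ)} (hU : IsUpperSet U) (w : σ →₀ ℕ)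
    (hw : ∀ n : N, (monomial w (1 : 𝕜)) • n = 0) (hc : col U w = U) {i : ℕ}
    (h1 : TU N (U ∪ Set.Ici w) (i + 1)) : TU N U i := by
  have hh := mi_col (𝕜 := 𝕜) hU w
  rw [hc] at hh
  obtain ⟨g, a, b, c⟩ := colon_ses _ _ _ _ hh (mi_sup U w)
  refine TZ_left' N _ g a b c h1 (torCxMap_smul N _ (monomial w 1) hw _ ?_ i)
  intro r
  obtain ⟨s, rfl⟩ := Submodule.Quotient.mk_surjective _ r
  rfl

lemma TU_empty_iff (i : ℕ) : TU N (∅ : Set (σ →₀ ℕ)) i ↔ TZ N (MvPolynomial σ 𝕜) i := by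
  have h : mi 𝕜 (∅ : Set (σ →₀ ℕ)) = ⊥ := by simp [mi]
  let e : (MvPolynomial σ 𝕜 ⧸ mi 𝕜 (∅ : Set (σ →₀ ℕ))) ≃ₗ[MvPolynomial σ 𝕜] MvPolynomial σ 𝕜 :=
    Submodule.quotEquivOfEqBot _ h
  rw [TU, TZ_iff_tor, TZ_iff_tor]
  exact (((Tor (ModuleCat (MvPolynomial σ 𝕜)) i).mapIso e.toModuleIso).app N).isZero_iff

/-- up-set generated by a family -/
def fam {ι : Type} (s : Finset ι) (g : ι → σ →₀ ℕ) : Set (σ →₀ ℕ) := {α | ∃ i ∈ s, g i ≤ α}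

lemma fam_upper {ι : Type} (s : Finset ι) (g : ι → σ →₀ ℕ) : IsUpperSet (fam s g) :=
  fun _ _ h ⟨i, hi, ha⟩ => ⟨i, hi, ha.trans h⟩

lemma fam_col {ι : Type} (s : Finset ι) (g : ι → σ →₀ ℕ) (w : σ →₀ ℕ) :
    col (fam s g) w = fam s (fun i => g i - w) := by
  ext α
  simp [col, fam]

lemma fam_insert {ι : Type} [DecidableEq ι] (s : Finset ι) (j : ι) (g : ι → σ →₀ ℕ) :
    fam (insert j s) g = fam s g ∪ Set.Ici (g j) := by
  ext α
  simp [fam, or_comm]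

lemma TU_fam {ι : Type} (s : Finset ι) : ∀ (g : ι → σ →₀ ℕ) (i : ℕ), s.card < i →
    TU N (fam s g) i := by
  classical
  induction s using Finset.induction_on with
  | empty =>
    intro g i hi
    have : fam (∅ : Finset ι) g = ∅ := by ext; simp [fam]
    rw [this, TU_empty_iff]
    obtain ⟨j, rfl⟩ : ∃ j, i = j + 1 := ⟨i - 1, by simp at hi; omega⟩
    exact TZ_self_succ N j
  | insert j s hj ih =>
    intro g i hi
    rw [Finset.card_insert_of_notMem hj] at hi
    obtain ⟨l, rfl⟩ : ∃ l, i = l + 1 := ⟨i - 1, by omega⟩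
    rw [fam_insert]
    refine TU_right N (fam_upper _ _) _ (ih g _ (by omega)) ?_
    rw [fam_col]
    exact ih _ _ (by omega)

lemma single_tsub_aux {a b : σ} (hne : a ≠ b) :
    (Finsupp.single a 1 - Finsupp.single b 1 : σ →₀ ℕ) = Finsupp.single a 1 := by
  classical
  ext y
  simp only [Finsupp.tsub_apply, Finsupp.single_apply]
  split_ifs with h1 h2
  · exact absurd (h1.trans h2.symm) hne
  · rfl
  · rfl
  · rfl

variable [Nontrivial N] (hN : ∀ (x : σ) (n : N), (X x : MvPolynomial σ 𝕜) • n = 0)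

include hN in
lemma not_TU_vars {ι : Type} (s : Finset ι) (x : ι → σ) (hx : Set.InjOn x s) :
    ¬ TU N (fam s (fun i => Finsupp.single (x i) 1)) s.card := by
  classical
  induction s using Finset.induction_on with
  | empty =>
    have : fam (∅ : Finset ι) (fun i => Finsupp.single (x i) 1) = ∅ := by ext; simp [fam]
    rw [this, TU_empty_iff]
    exact not_TZ_self_zero N
  | insert j s hj ih =>
    intro h
    rw [Finset.card_insert_of_notMem hj, fam_insert] at h
    refine ih (hx.mono (by simp)) (TU_left' N (fam_upper _ _) _ (hN (x j)) ?_ h)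
    rw [fam_col]
    ext α
    simp only [fam, Set.mem_ofPred_eq]
    refine exists_congr fun i => and_congr_right fun hi => ?_
    have hne : x i ≠ x j := fun h => hj (by
      have := hx (by simp [hi]) (by simp) h
      rwa [← this])
    rw [single_tsub_aux hne]

include hN in
lemma not_TU_dominant {ι : Type} (s : Finset ι) (x : ι → σ) : ∀ (d : ℕ) (g : ι → σ →₀ ℕ),
    ∑ i ∈ s, (g i).degree ≤ d →
    (∀ i ∈ s, 1 ≤ g i (x i)) →
    (∀ i ∈ s, ∀ j ∈ s, j ≠ i → g j (x i) < g i (x i)) → ¬ TU N (fam s g) s.card := by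
  classical
  intro d
  induction d with
  | zero =>
    intro g hd h1 _
    have : s = ∅ := by
      by_contra hs
      obtain ⟨i, hi⟩ := Finset.nonempty_iff_ne_empty.2 hs
      have h2 : (g i).degree ≤ _ :=
        Finset.single_le_sum (f := fun i => (g i).degree) (fun _ _ => Nat.zero_le _) hi
      have h3 := Finsupp.le_degree (x i) (g i)
      have := h1 i hi
      omega
    subst this
    have h0 := not_TU_vars N hN (∅ : Finset ι) x (by simp)
    have h1 : fam ∅ g = fam ∅ (fun i => Finsupp.single (x i) 1) := by ext; simp [fam]
    rwa [h1]
  | succ d ih =>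
    intro g hd h1 h2
    by_cases hall : ∀ i ∈ s, g i = Finsupp.single (x i) 1
    · have : fam s g = fam s (fun i => Finsupp.single (x i) 1) := by
        ext α
        simp only [fam, Set.mem_ofPred_eq]
        exact exists_congr fun i => and_congr_right fun hi => by rw [hall i hi]
      rw [this]
      refine not_TU_vars N hN s x ?_
      intro i hi j hj hij
      by_contra hne
      have := h2 i hi j hj (Ne.symm hne)
      rw [hij] at this
      have h4 := h2 j hj i hi hne
      rw [← hij] at h4 this
      omega
    · push Not at hall
      obtain ⟨i, hi, hne⟩ := hall
      obtain ⟨y, hy⟩ : ∃ y, Finsupp.single (x i) 1 y < g i y := by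
        by_contra hcon
        push Not at hcon
        apply hne
        refine le_antisymm hcon ?_
        rw [Finsupp.single_le_iff]
        exact h1 i hi
      have hgy : Finsupp.single y 1 ≤ g i := by
        rw [Finsupp.single_le_iff]; omega
      intro hTU
      have hk : ∀ k ∈ s, x k = y → 2 ≤ g k y := by
        rintro k hk rfl
        by_cases hki : k = i
        · subst hki
          simp at hy
          omega
        · have := h2 k hk i hi (Ne.symm hki)
          omega
      refine ih (fun k => g k - Finsupp.single y 1) ?_ ?_ ?_ (?_ : TU N _ s.card)
      · have : ∑ k ∈ s, (g k - Finsupp.single y 1).degree < ∑ k ∈ s, (g k).degree := by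
          refine Finset.sum_lt_sum (fun k _ => Finsupp.degree_mono tsub_le_self) ⟨i, hi, ?_⟩
          have h5 : (g i).degree = (g i - Finsupp.single y 1).degree + 1 := by
            conv_lhs => rw [← tsub_add_cancel_of_le hgy]
            simp
          omega
        omega
      · intro k hk'
        have := h1 k hk'
        simp only [Finsupp.tsub_apply, Finsupp.single_apply]
        split_ifs with h
        · have := hk k hk' h.symm
          rw [← h]; omega
        · omega
      · intro k hk' j hj hjk
        have h6 := h1 k hk'
        have h7 := h2 k hk' j hj hjk
        simp only [Finsupp.tsub_apply, Finsupp.single_apply]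
        split_ifs with h
        · have := hk k hk' h.symm
          rw [← h] at h6 h7 ⊢; omega
        · omega
      · rw [← fam_col]
        refine TU_left N (fam_upper _ _) _ ?_ hTU
        have : fam s g ∪ Set.Ici (Finsupp.single y 1) =
            fam s (Function.update g i (Finsupp.single y 1)) := by
          ext α
          simp only [fam, Set.mem_union, Set.mem_ofPred_eq, Set.mem_Ici]
          constructor
          · rintro (⟨k, hk', hα⟩ | hα)
            · by_cases hki : k = i
              · subst hki
                exact ⟨k, hk', by simpa using hgy.trans hα⟩
              · exact ⟨k, hk', by simpa [Function.update_of_ne hki] using hα⟩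
            · exact ⟨i, hi, by simpa using hα⟩
          · rintro ⟨k, hk', hα⟩
            by_cases hki : k = i
            · subst hki
              exact Or.inr (by simpa using hα)
            · exact Or.inl ⟨k, hk', by simpa [Function.update_of_ne hki] using hα⟩
        rw [this]
        exact TU_fam N s _ _ (by omega)

end Mono

section Comb
variable {𝕜 : Type} [Field 𝕜] {ι : Type} [Fintype ι] [DecidableEq ι]
  (N : ModuleCat.{0} (MvPolynomial (ι × Fin 2) 𝕜)) (s : Equiv.Perm ι)

/-- exponents of the monomials in `I_m` -/
def U0 : Set (ι × Fin 2 →₀ ℕ) :=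
  {α | (∃ i, 3 ≤ α (i, 0) ∧ 1 ≤ α (i, 1)) ∨
    ∃ i, 2 ≤ α (i, 0) ∧ 1 ≤ α (s i, 0) ∧ 1 ≤ α (s i, 1)}

lemma U0_upper : IsUpperSet (U0 s) := by
  rintro α β h (⟨i, h1, h2⟩ | ⟨i, h1, h2, h3⟩)
  · exact Or.inl ⟨i, h1.trans (h _), h2.trans (h _)⟩
  · exact Or.inr ⟨i, h1.trans (h _), h2.trans (h _), h3.trans (h _)⟩

/-- nodes of the splitting tree -/
def Node (u : ι × Fin 2 →₀ ℕ) (Z : Set (ι × Fin 2)) : Set (ι × Fin 2 →₀ ℕ) :=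
  {α | α + u ∈ U0 s ∨ ∃ x ∈ Z, 1 ≤ α x}

lemma Node_upper (u : ι × Fin 2 →₀ ℕ) (Z : Set (ι × Fin 2)) : IsUpperSet (Node s u Z) := by
  rintro α β h (h1 | ⟨x, hx, h1⟩)
  · exact Or.inl (U0_upper s (by gcongr) h1)
  · exact Or.inr ⟨x, hx, h1.trans (h _)⟩

lemma Node_col (u : ι × Fin 2 →₀ ℕ) (Z : Set (ι × Fin 2)) (x : ι × Fin 2) (hx : x ∉ Z) :
    col (Node s u Z) (Finsupp.single x 1) = Node s (u + Finsupp.single x 1) Z := by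
  ext α
  simp only [col, Node, Set.mem_ofPred_eq]
  refine or_congr (by rw [add_assoc, add_comm (Finsupp.single x 1)]) ?_
  refine exists_congr fun y => and_congr_right fun hy => ?_
  have : x ≠ y := fun h => hx (h ▸ hy)
  simp [Finsupp.single_apply, this]

lemma Node_union (u : ι × Fin 2 →₀ ℕ) (Z : Set (ι × Fin 2)) (x : ι × Fin 2) :
    Node s u Z ∪ Set.Ici (Finsupp.single x 1) = Node s u (insert x Z) := by
  ext α
  simp only [Node, Set.mem_union, Set.mem_ofPred_eq, Set.mem_Ici, Set.mem_insert_iff,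
    exists_eq_or_imp, Finsupp.single_le_iff]
  rw [or_assoc]
  exact or_congr Iff.rfl or_comm

/-- processed index -/
def Proc (u : ι × Fin 2 →₀ ℕ) (Z : Set (ι × Fin 2)) (i : ι) : Prop :=
  (u (i, 0) = 0 ∧ u (i, 1) = 0 ∧ (i, 0) ∉ Z ∧ (i, 1) ∈ Z) ∨
  (u (i, 0) < 2 ∧ u (i, 1) = 1 ∧ (i, 0) ∈ Z ∧ (i, 1) ∉ Z) ∨
  (u (i, 0) = 2 ∧ u (i, 1) = 1 ∧ (i, 0) ∉ Z ∧ (i, 1) ∉ Z)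

/-- unprocessed index -/
def Unproc (u : ι × Fin 2 →₀ ℕ) (Z : Set (ι × Fin 2)) (i : ι) : Prop :=
  u (i, 0) = 0 ∧ u (i, 1) = 0 ∧ (i, 0) ∉ Z ∧ (i, 1) ∉ Z

def NInv (u : ι × Fin 2 →₀ ℕ) (Z : Set (ι × Fin 2)) (S : Finset ι) : Prop :=
  ∀ i, (i ∈ S → Proc u Z i) ∧ (i ∉ S → Unproc u Z i)

lemma NInv_step {u u' : ι × Fin 2 →₀ ℕ} {Z Z' : Set (ι × Fin 2)} {S : Finset ι} {i : ι}
    (h : NInv u Z S) (hi : i ∉ S)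
    (hu : ∀ j, j ≠ i → ∀ b, u' (j, b) = u (j, b))
    (hZ : ∀ j, j ≠ i → ∀ b, ((j, b) ∈ Z' ↔ (j, b) ∈ Z)) (hp : Proc u' Z' i) :
    NInv u' Z' (insert i S) := by
  intro j
  by_cases hj : j = i
  · subst hj
    exact ⟨fun _ => hp, fun h => absurd (Finset.mem_insert_self _ _) h⟩
  · have hP : Proc u' Z' j ↔ Proc u Z j := by simp only [Proc, hu j hj, hZ j hj]
    have hQ : Unproc u' Z' j ↔ Unproc u Z j := by simp only [Unproc, hu j hj, hZ j hj]
    rw [hP, hQ, Finset.mem_insert, or_iff_right hj]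
    exact h j

lemma card_disj (D : Finset ι) (hD : ∀ i ∈ D, s i ∉ D) : D.card ≤ Fintype.card ι / 2 := by
  have h1 : Disjoint D (D.map s.toEmbedding) := by
    rw [Finset.disjoint_left]
    intro a ha hb
    obtain ⟨b, hb', rfl⟩ := Finset.mem_map.1 hb
    exact hD b hb' ha
  have h2 := Finset.card_le_univ (D ∪ D.map s.toEmbedding)
  rw [Finset.card_union_of_disjoint h1, Finset.card_map] at h2
  omega

lemma card_idx (D : Finset ι) :
    ((Finset.univ : Finset ι) ×ˢ {false} ∪ D ×ˢ {true}).card = Fintype.card ι + D.card := by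
  rw [Finset.card_union_of_disjoint]
  · simp
  · rw [Finset.disjoint_left]
    rintro ⟨a, b⟩ h1 h2
    simp at h1 h2
    simp [h1] at h2

lemma leaf (hc : 0 < Fintype.card ι) {u : ι × Fin 2 →₀ ℕ} {Z : Set (ι × Fin 2)}
    (h : NInv u Z Finset.univ)
    {l : ℕ} (hl : Fintype.card ι / 2 + Fintype.card ι < l) : TU N (Node s u Z) l := by
  have hP : ∀ i, Proc u Z i := fun i => (h i).1 (Finset.mem_univ _)
  by_cases hun : ∃ j, 2 ≤ u (j, 0) ∧ 1 ≤ u (s j, 0) ∧ 1 ≤ u (s j, 1)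
  · have : Node s u Z = fam ({()} : Finset Unit) (fun _ => 0) := by
      ext α
      obtain ⟨j, h1, h2, h3⟩ := hun
      simp only [Node, fam, Set.mem_ofPred_eq, zero_le, and_true]
      refine iff_of_true (Or.inl (Or.inr ⟨j, ?_, ?_, ?_⟩)) ⟨(), by simp⟩ <;>
        rw [Finsupp.add_apply] <;> omega
    rw [this]
    exact TU_fam N _ _ _ (by simp; omega)
  · push Not at hun
    let D : Finset ι := Finset.univ.filter fun j => u (j, 1) = 0 ∧ 1 ≤ u (s j, 0)
    let g : ι × Bool → (ι × Fin 2 →₀ ℕ) := fun p => if p.2 then Finsupp.single (p.1, 0) 2 else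
      if u (p.1, 1) = 0 then Finsupp.single (p.1, 1) 1 else Finsupp.single (p.1, 0) 1
    have hD : D.card ≤ Fintype.card ι / 2 := by
      refine card_disj s D fun i hi hsi => ?_
      simp only [D, Finset.mem_filter, Finset.mem_univ, true_and] at hi hsi
      rcases hP (s i) with h | h | h <;> omega
    have : Node s u Z = fam ((Finset.univ : Finset ι) ×ˢ {false} ∪ D ×ˢ {true}) g := by
      ext α
      have key : α ∈ fam ((Finset.univ : Finset ι) ×ˢ {false} ∪ D ×ˢ {true}) g ↔
          (∃ i, u (i, 1) = 0 ∧ 1 ≤ α (i, 1)) ∨ (∃ i, u (i, 1) ≠ 0 ∧ 1 ≤ α (i, 0)) ∨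
          (∃ i, u (i, 1) = 0 ∧ 1 ≤ u (s i, 0) ∧ 2 ≤ α (i, 0)) := by
        constructor
        · rintro ⟨⟨i, b⟩, hi, hα⟩
          cases b
          · by_cases h0 : u (i, 1) = 0
            · simp [g, h0] at hα
              exact Or.inl ⟨i, h0, by omega⟩
            · simp [g, h0] at hα
              exact Or.inr (Or.inl ⟨i, h0, by omega⟩)
          · simp [D] at hi
            simp [g] at hα
            exact Or.inr (Or.inr ⟨i, hi.1, by omega, hα⟩)
        · rintro (⟨i, h0, hα⟩ | ⟨i, h0, hα⟩ | ⟨i, h0, h1, hα⟩)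
          · exact ⟨(i, false), by simp, by simp [g, h0]; omega⟩
          · exact ⟨(i, false), by simp, by simp [g, h0]; omega⟩
          · exact ⟨(i, true), by simp [D, h0]; omega, by simp [g]; omega⟩
      rw [key]
      simp only [Node, U0, Set.mem_ofPred_eq, Finsupp.add_apply]
      constructor
      · rintro ((⟨i, h1, h2⟩ | ⟨i, h1, h2, h3⟩) | ⟨⟨i, b⟩, hx, h1⟩)
        · by_cases h0 : u (i, 1) = 0
          · exact Or.inl ⟨i, h0, by omega⟩
          · refine Or.inr (Or.inl ⟨i, h0, ?_⟩)
            rcases hP i with h | h | h <;> omega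
        · by_cases h0 : u (s i, 1) = 0
          · exact Or.inl ⟨s i, h0, by omega⟩
          · by_cases h4 : 1 ≤ α (s i, 0)
            · exact Or.inr (Or.inl ⟨s i, h0, h4⟩)
            · by_cases h5 : u (i, 1) = 0
              · refine Or.inr (Or.inr ⟨i, h5, by omega, ?_⟩)
                rcases hP i with h | h | h <;> omega
              · refine Or.inr (Or.inl ⟨i, h5, ?_⟩)
                have hq := hun i
                by_contra hcon
                have := hq (by omega) (by omega)
                omega
        · fin_cases b
          · refine Or.inr (Or.inl ⟨i, ?_, h1⟩)
            rcases hP i with h | h | h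
            · exact absurd hx h.2.2.1
            · omega
            · omega
          · refine Or.inl ⟨i, ?_, h1⟩
            rcases hP i with h | h | h
            · exact h.2.1
            · exact absurd hx h.2.2.2
            · exact absurd hx h.2.2.2
      · rintro (⟨i, h0, hα⟩ | ⟨i, h0, hα⟩ | ⟨i, h0, h1, hα⟩)
        · rcases hP i with h | h | h
          · exact Or.inr ⟨_, h.2.2.2, hα⟩
          · omega
          · omega
        · rcases hP i with h | h | h
          · omega
          · exact Or.inr ⟨_, h.2.2.1, hα⟩
          · exact Or.inl (Or.inl ⟨i, by omega, by omega⟩)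
        · refine Or.inl (Or.inr ⟨i, by omega, by omega, ?_⟩)
          rcases hP (s i) with h | h | h <;> omega
    rw [this]
    refine TU_fam N _ _ _ ?_
    rw [card_idx]
    omega

lemma step_aux {u : ι × Fin 2 →₀ ℕ} {Z : Set (ι × Fin 2)} {S : Finset ι}
    (h : NInv u Z S) {i : ι} (hi : i ∉ S) :
    NInv u (insert (i, 1) Z) (insert i S) ∧
    NInv (u + Finsupp.single (i, 1) 1) (insert (i, 0) Z) (insert i S) ∧
    NInv (u + Finsupp.single (i, 1) 1 + Finsupp.single (i, 0) 1)
      (insert (i, 0) Z) (insert i S) ∧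
    NInv (u + Finsupp.single (i, 1) 1 + Finsupp.single (i, 0) 1 + Finsupp.single (i, 0) 1)
      Z (insert i S) := by
  obtain ⟨h0, h1, h2, h3⟩ := (h i).2 hi
  have a1 : ∀ j, j ≠ i → ∀ b c : Fin 2, (Finsupp.single (i, b) 1 : ι × Fin 2 →₀ ℕ) (j, c) = 0 := by
    intro j hj b c
    rw [Finsupp.single_apply, if_neg]
    intro h
    exact hj (Prod.ext_iff.1 h).1.symm
  have a2 : ∀ j, j ≠ i → ∀ b c : Fin 2, ((j, b) ∈ insert (i, c) Z ↔ (j, b) ∈ Z) := by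
    intro j hj b c
    simp [hj]
  refine ⟨NInv_step h hi ?_ ?_ ?_, NInv_step h hi ?_ ?_ ?_, NInv_step h hi ?_ ?_ ?_,
    NInv_step h hi ?_ ?_ ?_⟩
  · intros; rfl
  · intro j hj b; exact a2 j hj b _
  · exact Or.inl ⟨h0, h1, by simp [h2], by simp⟩
  · intro j hj b; simp [a1 j hj]
  · intro j hj b; exact a2 j hj b _
  · exact Or.inr (Or.inl ⟨by simp [h0], by simp [h1], by simp, by simp [h3]⟩)
  · intro j hj b; simp [a1 j hj]
  · intro j hj b; exact a2 j hj b _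
  · exact Or.inr (Or.inl ⟨by simp [h0], by simp [h1], by simp, by simp [h3]⟩)
  · intro j hj b; simp [a1 j hj]
  · intros; rfl
  · exact Or.inr (Or.inr ⟨by simp [h0], by simp [h1], h2, h3⟩)

lemma good (hc : 0 < Fintype.card ι) (n : ℕ) : ∀ (u : ι × Fin 2 →₀ ℕ) (Z : Set (ι × Fin 2))
    (S : Finset ι), Sᶜ.card = n → NInv u Z S →
    ∀ l, Fintype.card ι / 2 + Fintype.card ι < l → TU N (Node s u Z) l := by
  induction n with
  | zero =>
    intro u Z S hS h l hl
    have : S = Finset.univ := by simpa using hS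
    subst this
    exact leaf N s hc h hl
  | succ n ih =>
    intro u Z S hS h l hl
    obtain ⟨i, hi⟩ := Finset.card_pos.1 (by omega : 0 < Sᶜ.card)
    rw [Finset.mem_compl] at hi
    have hS' : (insert i S)ᶜ.card = n := by
      rw [Finset.card_compl] at hS ⊢
      rw [Finset.card_insert_of_notMem hi]
      omega
    obtain ⟨h0, h1, h2, h3⟩ := (h i).2 hi
    obtain ⟨k1, k2, k3, k4⟩ := step_aux h hi
    refine TU_mid N (Node_upper _ _ _) (Finsupp.single (i, 1) 1) ?_ ?_
    · rw [Node_col _ _ _ _ h3]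
      refine TU_mid N (Node_upper _ _ _) (Finsupp.single (i, 0) 1) ?_ ?_
      · rw [Node_col _ _ _ _ h2]
        refine TU_mid N (Node_upper _ _ _) (Finsupp.single (i, 0) 1) ?_ ?_
        · rw [Node_col _ _ _ _ h2]
          exact ih _ _ _ hS' k4 l hl
        · rw [Node_union]
          exact ih _ _ _ hS' k3 l hl
      · rw [Node_union]
        exact ih _ _ _ hS' k2 l hl
    · rw [Node_union]
      exact ih _ _ _ hS' k1 l hl

lemma chain (hc : 0 < Fintype.card ι) {u : ι × Fin 2 →₀ ℕ} {Z : Set (ι × Fin 2)} {S : Finset ι}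
    (h : NInv u Z S) {i : ι} (hi : i ∉ S) {l : ℕ} (hl : Fintype.card ι / 2 + Fintype.card ι ≤ l)
    (hT : TU N (Node s u Z) l) :
    TU N (Node s
      (u + Finsupp.single (i, 1) 1 + Finsupp.single (i, 0) 1 + Finsupp.single (i, 0) 1) Z) l := by
  obtain ⟨h0, h1, h2, h3⟩ := (h i).2 hi
  obtain ⟨k1, k2, k3, k4⟩ := step_aux h hi
  rw [← Node_col _ _ _ _ h2]
  refine TU_left N (Node_upper _ _ _) _ ?_ ?_
  · rw [Node_union]
    exact good N s hc _ _ _ _ rfl k3 _ (by omega)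
  rw [← Node_col _ _ _ _ h2]
  refine TU_left N (Node_upper _ _ _) _ ?_ ?_
  · rw [Node_union]
    exact good N s hc _ _ _ _ rfl k2 _ (by omega)
  rw [← Node_col _ _ _ _ h3]
  refine TU_left N (Node_upper _ _ _) _ ?_ hT
  rw [Node_union]
  exact good N s hc _ _ _ _ rfl k1 _ (by omega)

lemma chain_all (hc : 0 < Fintype.card ι) {l : ℕ}
    (hl : Fintype.card ι / 2 + Fintype.card ι ≤ l)
    (hT : TU N (Node s 0 ∅) l) (F : Finset ι) :
    ∃ u : ι × Fin 2 →₀ ℕ, (∀ i, u (i, 0) = if i ∈ F then 2 else 0) ∧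
      (∀ i, u (i, 1) = if i ∈ F then 1 else 0) ∧ TU N (Node s u ∅) l := by
  induction F using Finset.induction_on with
  | empty => exact ⟨0, by simp, by simp, hT⟩
  | insert i F hi ih =>
    obtain ⟨u, h0, h1, hu⟩ := ih
    have hI : NInv u ∅ F := by
      intro j
      refine ⟨fun hj => Or.inr (Or.inr ?_), fun hj => ?_⟩
      · simp [h0, h1, hj]
      · simp [Unproc, h0, h1, hj]
    refine ⟨_, ?_, ?_, chain N s hc hI hi hl hu⟩
    · intro j
      by_cases hj : j = i
      · subst hj
        simp [h0, hi]
      · have : i ≠ j := fun h => hj h.symm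
        simp [h0, hj, Finsupp.single_apply, this]
    · intro j
      by_cases hj : j = i
      · subst hj
        simp [h1, hi]
      · have : i ≠ j := fun h => hj h.symm
        simp [h1, hj, Finsupp.single_apply, this]

lemma Node_zero : Node s 0 ∅ = U0 s := by
  ext α
  simp [Node]

theorem upper (hc : 0 < Fintype.card ι) (l : ℕ) (hl : Fintype.card ι / 2 + Fintype.card ι < l) :
    TU N (U0 s) l := by
  rw [← Node_zero]
  refine good N s hc _ _ _ ∅ rfl ?_ l hl
  intro i
  simp [Unproc]

theorem lower [Nontrivial N] (hN : ∀ (x : ι × Fin 2) (n : N),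
      (X x : MvPolynomial (ι × Fin 2) 𝕜) • n = 0)
    (hc : 0 < Fintype.card ι) (E : Finset ι) (hE1 : ∀ i ∈ E, s i ∉ E)
    (hE2 : ∀ i, i ∉ E → s i ∈ E ∨ s.symm i ∈ E) (hE : E.card = Fintype.card ι / 2)
    (hs : ∀ i, s i ≠ i) :
    ¬ TU N (U0 s) (Fintype.card ι / 2 + Fintype.card ι) := by
  intro hT
  rw [← Node_zero] at hT
  obtain ⟨u, h0, h1, hu⟩ := chain_all N s hc le_rfl hT E
  have hcard := card_idx E
  rw [hE, add_comm] at hcard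
  rw [← hcard] at hu
  let g : ι × Bool → (ι × Fin 2 →₀ ℕ) := fun p =>
    if p.2 then Finsupp.single (s.symm p.1, 0) 2 else
      if p.1 ∈ E then Finsupp.single (p.1, 0) 1 else
        Finsupp.single (s.symm p.1, 0) (if s.symm p.1 ∈ E then 0 else 2)
          + Finsupp.single (p.1, 0) 1 + Finsupp.single (p.1, 1) 1
  let x : ι × Bool → ι × Fin 2 := fun p =>
    if p.2 then (s.symm p.1, 0) else if p.1 ∈ E then (p.1, 0) else (p.1, 1)
  have hs' : ∀ i, s.symm i ≠ i := fun i h => hs i (by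
    conv_lhs => rw [← h]
    simp)
  have hE1' : ∀ i ∈ E, s.symm i ∉ E := fun i hi h => hE1 _ h (by simpa using hi)
  have gh : ∀ i, i ∉ E → ∀ α : ι × Fin 2 →₀ ℕ, g (i, false) ≤ α ↔
      ((s.symm i ∈ E ∨ 2 ≤ α (s.symm i, 0)) ∧ 1 ≤ α (i, 0) ∧ 1 ≤ α (i, 1)) := by
    intro i hi α
    have hne := hs' i
    have hne' := (hs' i).symm
    constructor
    · intro h
      have e1 := h (s.symm i, 0)
      have e2 := h (i, 0)
      have e3 := h (i, 1)
      simp [g, hi, Finsupp.single_apply, hne, hne'] at e1 e2 e3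
      refine ⟨?_, by omega, by omega⟩
      by_cases hh : s.symm i ∈ E
      · exact Or.inl hh
      · right
        simpa [hh] using e1
    · rintro ⟨e1, e2, e3⟩ ⟨j, b⟩
      fin_cases b
      · by_cases hj : j = i
        · subst hj
          simp [g, hi, Finsupp.single_apply, hne, hne']
          omega
        · have hj' : i ≠ j := fun h => hj h.symm
          by_cases hj2 : s.symm i = j
          · subst hj2
            by_cases hh : s.symm i ∈ E
            · simp [g, hi, Finsupp.single_apply, hne, hne', hh]
            · have := e1.resolve_left hh
              simpa [g, hi, Finsupp.single_apply, hne, hne', hh] using this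
          · simp [g, hi, Finsupp.single_apply, hj', hj2]
      · by_cases hj : j = i
        · subst hj
          simp [g, hi, Finsupp.single_apply]
          omega
        · have hj' : i ≠ j := fun h => hj h.symm
          simp [g, hi, Finsupp.single_apply, hj']
  have hfam : Node s u ∅ = fam ((Finset.univ : Finset ι) ×ˢ {false} ∪ E ×ˢ {true}) g := by
    ext α
    have key : α ∈ fam ((Finset.univ : Finset ι) ×ˢ {false} ∪ E ×ˢ {true}) g ↔
        (∃ i, i ∈ E ∧ 1 ≤ α (i, 0)) ∨
        (∃ i, i ∉ E ∧ (s.symm i ∈ E ∨ 2 ≤ α (s.symm i, 0)) ∧ 1 ≤ α (i, 0) ∧ 1 ≤ α (i, 1)) ∨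
        (∃ i, i ∈ E ∧ 2 ≤ α (s.symm i, 0)) := by
      constructor
      · rintro ⟨⟨i, b⟩, hi, hα⟩
        cases b
        · by_cases hiE : i ∈ E
          · simp [g, hiE] at hα
            exact Or.inl ⟨i, hiE, by omega⟩
          · rw [gh i hiE] at hα
            exact Or.inr (Or.inl ⟨i, hiE, hα⟩)
        · simp at hi
          simp [g] at hα
          exact Or.inr (Or.inr ⟨i, hi, hα⟩)
      · rintro (⟨i, hi, hα⟩ | ⟨i, hi, hα⟩ | ⟨i, hi, hα⟩)
        · exact ⟨(i, false), by simp, by simp [g, hi]; omega⟩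
        · exact ⟨(i, false), by simp, (gh i hi α).2 hα⟩
        · exact ⟨(i, true), by simp [hi], by simp [g]; omega⟩
    rw [key]
    simp only [Node, U0, Set.mem_ofPred_eq, Finsupp.add_apply, h0, h1, Set.mem_empty_iff_false,
      false_and, exists_false, or_false]
    constructor
    · rintro (⟨i, e1, e2⟩ | ⟨i, e1, e2, e3⟩)
      · by_cases hi : i ∈ E
        · simp [hi] at e1
          exact Or.inl ⟨i, hi, by omega⟩
        · simp [hi] at e1 e2
          rcases hE2 i hi with h | h
          · exact Or.inr (Or.inr ⟨s i, h, by simp; omega⟩)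
          · exact Or.inr (Or.inl ⟨i, hi, Or.inl h, by omega, by omega⟩)
      · by_cases hsi : s i ∈ E
        · have hi : i ∉ E := fun h => hE1 i h hsi
          simp [hi] at e1
          exact Or.inr (Or.inr ⟨s i, hsi, by simpa using e1⟩)
        · simp [hsi] at e2 e3
          refine Or.inr (Or.inl ⟨s i, hsi, ?_, by omega, by omega⟩)
          by_cases hi : i ∈ E
          · left; simpa using hi
          · right; simpa [hi] using e1
    · rintro (⟨i, hi, hα⟩ | ⟨i, hi, hα⟩ | ⟨i, hi, hα⟩)
      · exact Or.inl ⟨i, by simp [hi]; omega, by simp [hi]⟩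
      · refine Or.inr ⟨s.symm i, ?_, ?_, ?_⟩
        · rcases hα.1 with h | h
          · simp [h]
          · omega
        · simp only [Equiv.apply_symm_apply]; omega
        · simp only [Equiv.apply_symm_apply]; omega
      · exact Or.inr ⟨s.symm i, by omega, by simp [hi], by simp [hi]⟩
  rw [hfam] at hu
  refine not_TU_dominant N hN _ x _ g le_rfl ?_ ?_ hu
  · rintro ⟨i, b⟩ -
    cases b
    · by_cases hi : i ∈ E
      · simp [g, x, hi]
      · simp [g, x, hi]
    · simp [g, x]
  · rintro ⟨i, b⟩ hib ⟨j, c⟩ hjc hne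
    have hbE : b = true → i ∈ E := by rintro rfl; simpa using hib
    have hcE : c = true → j ∈ E := by rintro rfl; simpa using hjc
    cases b
    · by_cases hi : i ∈ E
      · have hx : x (i, false) = (i, 0) := by simp [x, hi]
        have hg : g (i, false) (i, 0) = 1 := by simp [g, hi]
        rw [hx, hg, Nat.lt_one_iff]
        cases c
        · have hji : j ≠ i := fun h => hne (by rw [h])
          by_cases hj : j ∈ E
          · simp [g, hj, Finsupp.single_apply, hji]
          · by_cases hji2 : s.symm j = i
            · simp [g, hj, hji2, hi, Finsupp.single_apply, hji]
            · simp [g, hj, Finsupp.single_apply, hji, hji2]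
        · have hj := hcE rfl
          have : s.symm j ≠ i := fun h => hE1' j hj (h ▸ hi)
          simp [g, Finsupp.single_apply, this]
      · have hx : x (i, false) = (i, 1) := by simp [x, hi]
        have hg : g (i, false) (i, 1) = 1 := by simp [g, hi]
        rw [hx, hg, Nat.lt_one_iff]
        cases c
        · have hji : j ≠ i := fun h => hne (by rw [h])
          by_cases hj : j ∈ E
          · simp [g, hj]
          · simp [g, hj, Finsupp.single_apply, hji]
        · simp [g]
    · have hi := hbE rfl
      have hx : x (i, true) = (s.symm i, 0) := by simp [x]
      have hg : g (i, true) (s.symm i, 0) = 2 := by simp [g]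
      rw [hx, hg]
      cases c
      · by_cases hj : j ∈ E
        · simp [g, hj, Finsupp.single_apply]
          split_ifs <;> omega
        · have hji : j ≠ i := fun h => hj (h ▸ hi)
          simp [g, hj, Finsupp.single_apply, hji]
          split_ifs <;> omega
      · have hji : j ≠ i := fun h => hne (by rw [h])
        simp [g, Finsupp.single_apply, hji]

end Comb

section Final

lemma rank_restrict_iff (𝕜 : Type) [Field 𝕜] (S : Type) [CommRing S] [Algebra 𝕜 S]
    {M : Type} [hM : AddCommGroup M] [hS : Module S M] :
    Module.rank 𝕜 (RestrictScalars 𝕜 S M) = 0 ↔ Subsingleton M := by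
  letI : Module 𝕜 M := Module.compHom M (algebraMap 𝕜 S)
  have h : Module.rank 𝕜 M = 0 ↔ Subsingleton M := rank_zero_iff
  exact h

lemma betti_eq_zero_iff (𝕜 : Type) [Field 𝕜] {σ : Type} (I : Ideal (MvPolynomial σ 𝕜)) (i : ℕ) :
    betti 𝕜 I i = 0 ↔ TZ (ModuleCat.of (MvPolynomial σ 𝕜)
      (MvPolynomial σ 𝕜 ⧸ Ideal.span (Set.range (X : σ → MvPolynomial σ 𝕜)))) I i := by
  rw [TZ_iff_tor, betti, ModuleCat.isZero_iff_subsingleton]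
  exact rank_restrict_iff 𝕜 (MvPolynomial σ 𝕜)

lemma TZ_ideal_iff {R : Type} [CommRing R] (N : ModuleCat.{0} R) (I : Ideal R) (l : ℕ) :
    TZ N I (l + 1) ↔ TZ N (R ⧸ I) (l + 1 + 1) := by
  have hex : Function.Exact I.subtype I.mkQ := LinearMap.exact_subtype_mkQ I
  have hi : Function.Injective I.subtype := Subtype.val_injective
  have hs : Function.Surjective I.mkQ := Submodule.mkQ_surjective I
  exact ⟨fun h => TZ_right N _ _ hi hs hex (TZ_self_succ N _) h,
    fun h => TZ_left N _ _ hi hs hex h (TZ_self_succ N _)⟩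

instance resid_nontrivial (𝕜 : Type) [Field 𝕜] (σ : Type) :
    Nontrivial (MvPolynomial σ 𝕜 ⧸ Ideal.span (Set.range (X : σ → MvPolynomial σ 𝕜))) := by
  rw [Ideal.Quotient.nontrivial_iff]
  intro h
  have h1 : Ideal.span (Set.range (X : σ → MvPolynomial σ 𝕜)) ≤
      RingHom.ker (constantCoeff : MvPolynomial σ 𝕜 →+* 𝕜) := by
    rw [Ideal.span_le]
    rintro _ ⟨x, rfl⟩
    simp [RingHom.mem_ker]
  rw [h] at h1
  have := h1 (Submodule.mem_top : (1 : MvPolynomial σ 𝕜) ∈ _)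
  simp [RingHom.mem_ker] at this

lemma resid_smul (𝕜 : Type) [Field 𝕜] (σ : Type) (x : σ)
    (n : MvPolynomial σ 𝕜 ⧸ Ideal.span (Set.range (X : σ → MvPolynomial σ 𝕜))) :
    (X x : MvPolynomial σ 𝕜) • n = 0 := by
  obtain ⟨r, rfl⟩ := Ideal.Quotient.mk_surjective n
  rw [← Ideal.Quotient.mk_eq_mk, ← Submodule.Quotient.mk_smul, Submodule.Quotient.mk_eq_zero]
  exact Ideal.mul_mem_right _ _ (Ideal.subset_span ⟨x, rfl⟩)

lemma p_le {ι : Type} (i : ι) (α : ι × Fin 2 →₀ ℕ) :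
    Finsupp.single (i, (0 : Fin 2)) 3 + Finsupp.single (i, 1) 1 ≤ α ↔
      3 ≤ α (i, 0) ∧ 1 ≤ α (i, 1) := by
  classical
  constructor
  · intro h
    have e1 := h (i, 0)
    have e2 := h (i, 1)
    simp at e1 e2
    omega
  · rintro ⟨e1, e2⟩ ⟨j, b⟩
    by_cases hj : i = j
    · subst hj
      fin_cases b <;> simp <;> omega
    · simp [Finsupp.single_apply, hj]

lemma q_le {ι : Type} (i k : ι) (hk : k ≠ i) (α : ι × Fin 2 →₀ ℕ) :
    Finsupp.single (i, (0 : Fin 2)) 2 + Finsupp.single (k, (0 : Fin 2)) 1 +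
      Finsupp.single (k, (1 : Fin 2)) 1 ≤ α ↔
      2 ≤ α (i, 0) ∧ 1 ≤ α (k, 0) ∧ 1 ≤ α (k, 1) := by
  classical
  have hk' := hk.symm
  constructor
  · intro h
    have e1 := h (i, 0)
    have e2 := h (k, 0)
    have e3 := h (k, 1)
    simp [Finsupp.single_apply, hk, hk'] at e1 e2 e3
    omega
  · rintro ⟨e1, e2, e3⟩ ⟨j, b⟩
    by_cases hj : i = j
    · subst hj
      fin_cases b
      · simp [Finsupp.single_apply, hk]; omega
      · simp [Finsupp.single_apply, hk]
    · by_cases hj2 : k = j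
      · subst hj2
        fin_cases b <;> simp [Finsupp.single_apply, hj] <;> omega
      · simp [Finsupp.single_apply, hj, hj2]

lemma ideal_eq {𝕜 : Type} [Field 𝕜] {ι : Type} (s : Equiv.Perm ι) (hs : ∀ i, s i ≠ i) :
    Ideal.span { f : MvPolynomial (ι × Fin 2) 𝕜 |
      (∃ i : ι,
        f = monomial (Finsupp.single (i, (0 : Fin 2)) 3 + Finsupp.single (i, 1) 1) (1 : 𝕜)) ∨
      (∃ i : ι,
        f = monomial (Finsupp.single (i, (0 : Fin 2)) 2 +
          Finsupp.single (s i, (0 : Fin 2)) 1 +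
          Finsupp.single (s i, (1 : Fin 2)) 1) (1 : 𝕜)) } = mi 𝕜 (U0 s) := by
  apply le_antisymm
  · rw [Ideal.span_le]
    rintro f (⟨i, rfl⟩ | ⟨i, rfl⟩)
    · exact Ideal.subset_span ⟨_, Or.inl ⟨i, (p_le i _).1 le_rfl⟩, rfl⟩
    · exact Ideal.subset_span ⟨_, Or.inr ⟨i, (q_le i _ (hs i) _).1 le_rfl⟩, rfl⟩
  · rw [mi, Ideal.span_le]
    have key : ∀ {β α : ι × Fin 2 →₀ ℕ}, β ≤ α →
        (monomial α (1 : 𝕜)) = monomial (α - β) 1 * monomial β 1 := by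
      intro β α h
      rw [monomial_mul, tsub_add_cancel_of_le h, mul_one]
    rintro _ ⟨α, (⟨i, h⟩ | ⟨i, h⟩), rfl⟩
    · have := key ((p_le i α).2 h)
      simp only [SetLike.mem_coe]
      rw [this]
      exact Ideal.mul_mem_left _ _ (Ideal.subset_span (Or.inl ⟨i, rfl⟩))
    · have := key ((q_le i _ (hs i) α).2 h)
      simp only [SetLike.mem_coe]
      rw [this]
      exact Ideal.mul_mem_left _ _ (Ideal.subset_span (Or.inr ⟨i, rfl⟩))

lemma card_odd (m : ℕ) : ((Finset.univ : Finset (Fin m)).filter fun i => i.val % 2 = 1).card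
    = m / 2 := by
  rw [Finset.card_filter, Fin.sum_univ_eq_sum_range (fun i => if i % 2 = 1 then 1 else 0) m]
  induction m with
  | zero => simp
  | succ n ih =>
    rw [Finset.sum_range_succ, ih]
    split_ifs <;> omega

lemma shift_val (m : ℕ) (hm : 1 < m) (i : Fin m) :
    ((i + ⟨1, hm⟩ : Fin m)).val = if i.val + 1 = m then 0 else i.val + 1 := by
  rw [Fin.val_add]
  have := i.isLt
  split_ifs with h
  · simp [h]
  · exact Nat.mod_eq_of_lt (by simp; omega)

lemma shift_bij (m : ℕ) (hm : 1 < m) :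
    Function.Bijective (fun i : Fin m => i + ⟨1, hm⟩) := by
  rw [← Finite.injective_iff_bijective]
  intro i j h
  have h' := congrArg Fin.val h
  simp only [shift_val m hm] at h'
  have := i.isLt
  have := j.isLt
  ext
  split_ifs at h' <;> omega

end Final

/-- `projdim(I_m) = ⌊m/2⌋ + m − 1`: the Betti number `β_{⌊m/2⌋+m−1}(I_m)` is nonzero and
`β_i(I_m) = 0` for `i > ⌊m/2⌋ + m − 1`. Variables `x_{i,1}, x_{i,2}` are indexed by
`(i-1, 0), (i-1, 1) : Fin m × Fin 2`, the first index being cyclic mod `m`. -/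
theorem stmt8 {𝕜 : Type} [Field 𝕜] (m : ℕ) (hm : 3 ≤ m)
    (I : Ideal (MvPolynomial (Fin m × Fin 2) 𝕜))
    (hI : I = Ideal.span { f |
      (∃ i : Fin m,
        f = monomial (Finsupp.single (i, (0 : Fin 2)) 3 + Finsupp.single (i, 1) 1) (1 : 𝕜)) ∨
      (∃ i : Fin m,
        f = monomial (Finsupp.single (i, (0 : Fin 2)) 2 +
          Finsupp.single (i + ⟨1, by omega⟩, (0 : Fin 2)) 1 +
          Finsupp.single (i + ⟨1, by omega⟩, (1 : Fin 2)) 1) (1 : 𝕜)) }) :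
    betti 𝕜 I (m / 2 + m - 1) ≠ 0 ∧
    ∀ i : ℕ, m / 2 + m - 1 < i → betti 𝕜 I i = 0 := by

  have hm1 : 1 < m := by omega
  let s : Equiv.Perm (Fin m) := Equiv.ofBijective _ (shift_bij m hm1)
  have hsv : ∀ i : Fin m, (s i).val = if i.val + 1 = m then 0 else i.val + 1 := shift_val m hm1
  have hs : ∀ i, s i ≠ i := by
    intro i h
    have h' := congrArg Fin.val h
    rw [hsv] at h'
    split_ifs at h' <;> omega
  have hI' : I = mi 𝕜 (U0 s) := hI.trans (ideal_eq s hs)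
  have hc : 0 < Fintype.card (Fin m) := by rw [Fintype.card_fin]; omega
  subst hI'
  constructor
  · rw [Ne, betti_eq_zero_iff]
    obtain ⟨l, hl⟩ : ∃ l, m / 2 + m = l + 1 + 1 := ⟨m / 2 + m - 2, by omega⟩
    have hl' : m / 2 + m - 1 = l + 1 := by omega
    rw [hl', TZ_ideal_iff, ← hl]
    have : Nontrivial (ModuleCat.of (MvPolynomial (Fin m × Fin 2) 𝕜) (MvPolynomial (Fin m × Fin 2) 𝕜 ⧸
      Ideal.span (Set.range (X : Fin m × Fin 2 → MvPolynomial (Fin m × Fin 2) 𝕜)))) :=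
      resid_nontrivial 𝕜 (Fin m × Fin 2)
    have hlow := lower (ModuleCat.of (MvPolynomial (Fin m × Fin 2) 𝕜) (MvPolynomial (Fin m × Fin 2) 𝕜 ⧸
      Ideal.span (Set.range (X : Fin m × Fin 2 → MvPolynomial (Fin m × Fin 2) 𝕜)))) s
      (resid_smul 𝕜 (Fin m × Fin 2)) hc (Finset.univ.filter fun i => i.val % 2 = 1) ?_ ?_ ?_ hs
    · rw [Fintype.card_fin] at hlow
      exact hlow
    · intro i hi hsi
      simp only [Finset.mem_filter, Finset.mem_univ, true_and, hsv] at hi hsi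
      split_ifs at hsi <;> omega
    · intro i hi
      simp only [Finset.mem_filter, Finset.mem_univ, true_and] at hi ⊢
      have h1 := hsv i
      have h2 := hsv (s.symm i)
      rw [Equiv.apply_symm_apply] at h2
      have := i.isLt
      have := (s.symm i).isLt
      split_ifs at h1 h2 <;> omega
    · rw [Fintype.card_fin, card_odd]
  · intro i hi
    rw [betti_eq_zero_iff]
    obtain ⟨l, rfl⟩ : ∃ l, i = l + 1 := ⟨i - 1, by omega⟩
    rw [TZ_ideal_iff]
    exact upper _ s hc _ (by rw [Fintype.card_fin]; omega)
end
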